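/- arXiv:1907.08365 — 9 statements merged into one kernel-verified Lean document; each statement's English description precedes it below -/
import Mathlib

section
/- Let a > 1, d > 0, and let c₁, c₂ : (−d, d) → ℝ be smooth functions with c₁(r) > 0, c₁(r)² = a²(1 − c₂(r)²), c₁′(r)² + c₂′(r)² = 1 and c₂′(r) > 0 for all r ∈ (−d, d). Then c₁′(r)² − c₁(r)·c₁″(r) − 1 > 0 for every r ∈ (−d, d). -/
open Real Set

/-- For the arc-length parametrization `r ↦ (c₁ r, c₂ r)` (with increasing
second coordinate) of the right half of the ellipse `x² = a²(1 - z²)` with `a > 1`,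
one has `c₁′² - c₁·c₁″ - 1 > 0` on `(-d, d)`. -/
theorem ellipse_profile_curvature_pos
    (a d : ℝ) (ha : 1 < a) (hd : 0 < d) (c₁ c₂ : ℝ → ℝ)
    (hc₁ : ContDiffOn ℝ (⊤ : ℕ∞) c₁ (Ioo (-d) d))
    (hc₂ : ContDiffOn ℝ (⊤ : ℕ∞) c₂ (Ioo (-d) d))
    (hpos : ∀ r ∈ Ioo (-d) d, 0 < c₁ r)
    (hell : ∀ r ∈ Ioo (-d) d, (c₁ r) ^ 2 = a ^ 2 * (1 - (c₂ r) ^ 2))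
    (harc : ∀ r ∈ Ioo (-d) d, (deriv c₁ r) ^ 2 + (deriv c₂ r) ^ 2 = 1)
    (hmono : ∀ r ∈ Ioo (-d) d, 0 < deriv c₂ r) :
    ∀ r ∈ Ioo (-d) d,
      0 < (deriv c₁ r) ^ 2 - c₁ r * deriv (deriv c₁) r - 1 := by
  intro r hr
  have hnhds : Ioo (-d) d ∈ nhds r := isOpen_Ioo.mem_nhds hr
  have hderiv {f : ℝ → ℝ} (hf : ContDiffOn ℝ (⊤ : ℕ∞) f (Ioo (-d) d)) {s : ℝ}
      (hs : s ∈ Ioo (-d) d) : HasDerivAt f (deriv f s) s :=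
    ((hf.differentiableOn (by simp)).differentiableAt (isOpen_Ioo.mem_nhds hs)).hasDerivAt
  have hderiv₂ {f : ℝ → ℝ} (hf : ContDiffOn ℝ (⊤ : ℕ∞) f (Ioo (-d) d)) :
      HasDerivAt (deriv f) (deriv (deriv f) r) r :=
    hderiv (hf.deriv_of_isOpen isOpen_Ioo (by simp)) hr
  have hell' : ∀ s ∈ Ioo (-d) d, c₁ s * deriv c₁ s = -a ^ 2 * (c₂ s * deriv c₂ s) := by
    intro s hs
    have hleft := (hderiv hc₁ hs).fun_pow 2
    have hright := (((hderiv hc₂ hs).fun_pow 2).const_sub 1).const_mul (a ^ 2)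
    have heq := hleft.unique (hright.congr_of_eventuallyEq
      (Filter.eventually_of_mem (isOpen_Ioo.mem_nhds hs) hell))
    norm_num at heq
    linarith
  have hell'' : deriv c₁ r * deriv c₁ r + c₁ r * deriv (deriv c₁) r =
      -a ^ 2 * (deriv c₂ r * deriv c₂ r + c₂ r * deriv (deriv c₂) r) :=
    ((hderiv hc₁ hr).fun_mul (hderiv₂ hc₁)).unique
      ((((hderiv hc₂ hr).fun_mul (hderiv₂ hc₂)).const_mul (-a ^ 2)).congr_of_eventuallyEq
        (Filter.eventually_of_mem hnhds hell'))
  have harc' : deriv c₁ r * deriv (deriv c₁) r + deriv c₂ r * deriv (deriv c₂) r = 0 := by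
    have heq := (((hderiv₂ hc₁).fun_pow 2).fun_add ((hderiv₂ hc₂).fun_pow 2)).unique
      ((hasDerivAt_const r (1 : ℝ)).congr_of_eventuallyEq (Filter.eventually_of_mem hnhds harc))
    norm_num at heq
    linarith
  have hcurv : (deriv c₁ r) ^ 2 - c₁ r * deriv (deriv c₁) r - 1 =
      (a ^ 2 - 1) * (deriv c₂ r) ^ 4 := by
    linear_combination (1 + c₁ r * deriv (deriv c₁) r + (deriv c₂ r) ^ 2) * harc r hr
      - (deriv c₂ r) ^ 2 * hell'' - deriv (deriv c₁) r * deriv c₁ r * hell' r hr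
      + a ^ 2 * c₂ r * deriv c₂ r * harc'
  rw [hcurv]
  have ha' : 0 < a ^ 2 - 1 := by nlinarith
  have hq := hmono r hr
  positivity
end

section
/- Let a > 0, d > 0, and let c₁, c₂ : (−d, d) → ℝ be smooth functions with c₁(r) > 0, c₁(r)² = a²(1 − c₂(r)²), c₁′(r)² + c₂′(r)² = 1 and c₂′(r) > 0 for all r ∈ (−d, d). Then for every r ∈ (−d, d), c₁′(r)² − c₁(r)·c₁″(r) − 1 = (a² − 1)·c₁(r)⁴ / (c₁(r)² + a⁴·c₂(r)²)². -/
open Real Set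

/-- For the arc-length parametrization of the right half of the ellipse
`x² = a²(1 - z²)`, one has
`c₁′² - c₁·c₁″ - 1 = (a² - 1)·c₁⁴ / (c₁² + a⁴·c₂²)²` on `(-d, d)`. -/
theorem ellipse_profile_curvature_formula
    (a d : ℝ) (ha : 0 < a) (hd : 0 < d) (c₁ c₂ : ℝ → ℝ)
    (hc₁ : ContDiffOn ℝ (⊤ : ℕ∞) c₁ (Ioo (-d) d))
    (hc₂ : ContDiffOn ℝ (⊤ : ℕ∞) c₂ (Ioo (-d) d))
    (hpos : ∀ r ∈ Ioo (-d) d, 0 < c₁ r)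
    (hell : ∀ r ∈ Ioo (-d) d, (c₁ r) ^ 2 = a ^ 2 * (1 - (c₂ r) ^ 2))
    (harc : ∀ r ∈ Ioo (-d) d, (deriv c₁ r) ^ 2 + (deriv c₂ r) ^ 2 = 1)
    (hmono : ∀ r ∈ Ioo (-d) d, 0 < deriv c₂ r) :
    ∀ r ∈ Ioo (-d) d,
      (deriv c₁ r) ^ 2 - c₁ r * deriv (deriv c₁) r - 1
        = (a ^ 2 - 1) * (c₁ r) ^ 4 / ((c₁ r) ^ 2 + a ^ 4 * (c₂ r) ^ 2) ^ 2 := by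
  intro r hr
  have hd₁ : ∀ t ∈ Ioo (-d) d, HasDerivAt c₁ (deriv c₁ t) t := fun t ht =>
    ((hc₁.differentiableOn (by simp)).differentiableAt (isOpen_Ioo.mem_nhds ht)).hasDerivAt
  have hd₂ : ∀ t ∈ Ioo (-d) d, HasDerivAt c₂ (deriv c₂ t) t := fun t ht =>
    ((hc₂.differentiableOn (by simp)).differentiableAt (isOpen_Ioo.mem_nhds ht)).hasDerivAt
  have hdd₁ : HasDerivAt (deriv c₁) (deriv (deriv c₁) r) r :=
    (((hc₁.deriv_of_isOpen (m := 1) isOpen_Ioo (by norm_cast)).differentiableOn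
      (by simp)).differentiableAt (isOpen_Ioo.mem_nhds hr)).hasDerivAt
  have hdd₂ : HasDerivAt (deriv c₂) (deriv (deriv c₂) r) r :=
    (((hc₂.deriv_of_isOpen (m := 1) isOpen_Ioo (by norm_cast)).differentiableOn
      (by simp)).differentiableAt (isOpen_Ioo.mem_nhds hr)).hasDerivAt
  have eq_of_eqOn : ∀ {f g : ℝ → ℝ} {f' g' t : ℝ}, t ∈ Ioo (-d) d → EqOn f g (Ioo (-d) d) →
      HasDerivAt f f' t → HasDerivAt g g' t → f' = g' := fun ht hfg hf hg =>
    hf.unique (hg.congr_of_eventuallyEq (hfg.eventuallyEq_of_mem (isOpen_Ioo.mem_nhds ht)))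
  have hell' : ∀ t ∈ Ioo (-d) d, c₁ t * deriv c₁ t = -a ^ 2 * (c₂ t * deriv c₂ t) := by
    intro t ht
    have h := eq_of_eqOn ht hell ((hd₁ t ht).pow 2)
      ((((hd₂ t ht).pow 2).const_sub 1).const_mul (a ^ 2))
    norm_num at h
    linarith
  have hell'' := eq_of_eqOn hr hell' ((hd₁ r hr).mul hdd₁)
    (((hd₂ r hr).mul hdd₂).const_mul (-a ^ 2))
  have harc' := eq_of_eqOn hr harc ((hdd₁.pow 2).add (hdd₂.pow 2)) (hasDerivAt_const r 1)
  norm_num at harc'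
  have hx := hpos r hr
  have hp := hmono r hr
  have h1 := hell' r hr
  have h2 := harc r hr
  generalize deriv (deriv c₁) r = x'' at *
  generalize deriv (deriv c₂) r = z'' at *
  generalize deriv c₁ r = x' at *
  generalize deriv c₂ r = z' at *
  generalize c₁ r = x at *
  generalize c₂ r = z at *
  have hS : 0 < x ^ 2 + a ^ 4 * z ^ 2 := by positivity
  have hz' : z' ^ 2 * (x ^ 2 + a ^ 4 * z ^ 2) = x ^ 2 := by
    linear_combination x ^ 2 * h2 - (x * x' - a ^ 2 * (z * z')) * h1
  have hx'' : x'' * (x ^ 2 + a ^ 4 * z ^ 2) = -x * (a ^ 2 * z' ^ 2 + x' ^ 2) := by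
    apply mul_right_cancel₀ hp.ne'
    linear_combination x * z' * hell'' - a ^ 2 * x * z / 2 * harc' + a ^ 2 * z * x'' * h1
  have hlhs : x' ^ 2 - x * x'' - 1 = (a ^ 2 - 1) * z' ^ 4 := by
    apply mul_right_cancel₀ hS.ne'
    linear_combination (x ^ 2 + a ^ 4 * z ^ 2) * h2 - x * hx''
      - (a ^ 2 * z' ^ 2 + x' ^ 2) * hz' + (x ^ 2 + a ^ 4 * z ^ 2) * z' ^ 2 * h2
  rw [hlhs, eq_div_iff (by positivity)]
  linear_combination (a ^ 2 - 1) * (z' ^ 2 * (x ^ 2 + a ^ 4 * z ^ 2) + x ^ 2) * hz'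
end

section
/- Let F : (−π/2, π/2) → ℝ be continuous and bounded, and let W₁ : (−π/2, π/2) × ℝ → ℝ be of class C², 2π-periodic in its second variable θ, bounded together with its first partial derivatives, and satisfying ∫_{−π}^{π} W₁(r, θ) dθ = 0 for every r ∈ (−π/2, π/2). Then ∫_{−π/2}^{π/2} ∫_{−π}^{π} F(r)²·cos r·( (∂_θW₁(r,θ))² + cos²r·(∂_rW₁(r,θ))² − W₁(r,θ)² ) dθ dr ≥ 0. Equivalently, the Misiołek curvature MC_{V,W} of the zonal flow V = F(r)∂_θ on the round 2-sphere with any divergence-free vector field W = W₁∂_r + W₂∂_θ is nonpositive. -/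
open Real Set

/-- **Wirtinger's inequality**: a `C¹` function with zero mean on `[-π, π]` and equal values at the
endpoints has `L²` norm on this interval at most that of its derivative. -/
theorem integral_sq_le_integral_deriv_sq_of_integral_eq_zero {f : ℝ → ℝ} (hf : ContDiff ℝ 1 f)
    (hends : f π = f (-π)) (hmean : (∫ x in (-π)..π, f x) = 0) :
    (∫ x in (-π)..π, f x ^ 2) ≤ ∫ x in (-π)..π, deriv f x ^ 2 := by
  have hab : -π < π := by linarith [pi_pos]
  have hparseval (g : ℝ → ℝ) (hg : Continuous g) :
      HasSum (fun n => ‖fourierCoeffOn hab (fun x => (g x : ℂ)) n‖ ^ 2)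
        ((π - -π)⁻¹ • ∫ x in (-π)..π, g x ^ 2) := by
    have hgc : Continuous fun x => (g x : ℂ) := Complex.continuous_ofReal.comp hg
    have hL2 : MeasureTheory.MemLp (fun x => (g x : ℂ)) 2
        (MeasureTheory.volume.restrict (Ioc (-π) π)) :=
      (MeasureTheory.memLp_two_iff_integrable_sq_norm hgc.aestronglyMeasurable).2
        (hgc.norm.pow 2).integrableOn_Ioc
    simpa using hasSum_sq_fourierCoeffOn hab hL2
  have hderiv : Continuous (deriv f) := hf.continuous_deriv_one
  have hcoeff (n : ℤ) : ‖fourierCoeffOn hab (fun x => (f x : ℂ)) n‖ ^ 2 ≤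
      ‖fourierCoeffOn hab (fun x => ((deriv f x : ℝ) : ℂ)) n‖ ^ 2 := by
    rcases eq_or_ne n 0 with rfl | hn
    · have h0 : fourierCoeffOn hab (fun x => (f x : ℂ)) 0 = 0 := by
        simp [fourierCoeffOn_eq_integral, intervalIntegral.integral_ofReal, hmean]
      rw [h0]
      simp
    · have hc := fourierCoeffOn_of_hasDerivAt hab hn
        (f := fun x => (f x : ℂ)) (f' := fun x => ((deriv f x : ℝ) : ℂ))
        (fun x _ => ((hf.differentiable one_ne_zero) x).hasDerivAt.ofReal_comp)
        ((Complex.continuous_ofReal.comp hderiv).intervalIntegrable _ _)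
      have hnorm : ‖fourierCoeffOn hab (fun x => (f x : ℂ)) n‖ * |(n : ℝ)| =
          ‖fourierCoeffOn hab (fun x => ((deriv f x : ℝ) : ℂ)) n‖ := by
        have hnc : (n : ℂ) ≠ 0 := by exact_mod_cast hn
        have hpi : (π : ℂ) ≠ 0 := by exact_mod_cast pi_ne_zero
        have hmul : fourierCoeffOn hab (fun x => ((deriv f x : ℝ) : ℂ)) n =
            Complex.I * n * fourierCoeffOn hab (fun x => (f x : ℂ)) n := by
          rw [hc, hends]
          push_cast
          field_simp
          ring
        rw [hmul]
        simp [mul_comm]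
      have hn1 : (1 : ℝ) ≤ |(n : ℝ)| := by exact_mod_cast Int.one_le_abs hn
      rw [← hnorm]
      gcongr
      exact le_mul_of_one_le_right (norm_nonneg _) hn1
  have hle := hasSum_le hcoeff (hparseval f hf.continuous) (hparseval _ hderiv)
  exact le_of_mul_le_mul_left hle (inv_pos.2 (by linarith))

/-- On the round 2-sphere with metric `dr² + cos²r·dθ²`, the Misiołek
curvature `MC_{V,W}` of any zonal flow `V = F(r)∂_θ` with any divergence-free field
`W = W₁∂_r + W₂∂_θ` is nonpositive; equivalently, the integral
`∫∫ F²·cos r·((∂_θW₁)² + cos²r·(∂_rW₁)² - W₁²) dθ dr` is nonnegative, where `W₁` is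
`2π`-periodic in `θ`, bounded with bounded first partial derivatives, and has zero
mean `∫_{-π}^{π} W₁(r,θ) dθ = 0` for every `r` (forced by divergence-freeness). -/
theorem sphere_misiolek_curvature_nonpos
    (F : ℝ → ℝ) (W₁ : ℝ → ℝ → ℝ)
    (hF : ContinuousOn F (Ioo (-(π / 2)) (π / 2)))
    (hFb : ∃ C : ℝ, ∀ r ∈ Ioo (-(π / 2)) (π / 2), |F r| ≤ C)
    (hW : ContDiffOn ℝ 2 (fun p : ℝ × ℝ => W₁ p.1 p.2)
      ((Ioo (-(π / 2)) (π / 2)) ×ˢ (univ : Set ℝ)))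
    (hper : ∀ r ∈ Ioo (-(π / 2)) (π / 2), ∀ θ : ℝ, W₁ r (θ + 2 * π) = W₁ r θ)
    (hWb : ∃ C : ℝ, ∀ r ∈ Ioo (-(π / 2)) (π / 2), ∀ θ : ℝ,
      |W₁ r θ| ≤ C ∧ |deriv (W₁ r) θ| ≤ C ∧ |deriv (fun s => W₁ s θ) r| ≤ C)
    (hmean : ∀ r ∈ Ioo (-(π / 2)) (π / 2), (∫ θ in (-π)..π, W₁ r θ) = 0) :
    0 ≤ ∫ r in (-(π / 2))..(π / 2), ∫ θ in (-π)..π,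
      F r ^ 2 * Real.cos r *
        ((deriv (W₁ r) θ) ^ 2 + (Real.cos r) ^ 2 * (deriv (fun s => W₁ s θ) r) ^ 2
          - (W₁ r θ) ^ 2) := by
  refine intervalIntegral.integral_nonneg (by linarith [pi_pos]) fun r hr => ?_
  rw [intervalIntegral.integral_const_mul]
  rcases (cos_nonneg_of_mem_Icc hr).eq_or_lt with hcos | hcos
  · simp [← hcos]
  have hr' : r ∈ Ioo (-(π / 2)) (π / 2) := by
    refine ⟨hr.1.lt_of_ne ?_, hr.2.lt_of_ne ?_⟩
    · rintro rfl
      simp at hcos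
    · rintro rfl
      simp at hcos
  refine mul_nonneg (mul_nonneg (sq_nonneg _) hcos.le) ?_
  have hWr : ContDiff ℝ 2 (W₁ r) := by
    rw [← contDiffOn_univ]
    exact hW.comp (f := fun θ : ℝ => (r, θ)) (contDiff_prodMk_right r).contDiffOn
      fun θ _ => ⟨hr', mem_univ θ⟩
  have hWr1 : ContDiff ℝ 1 (W₁ r) := hWr.of_le one_le_two
  have hends : W₁ r π = W₁ r (-π) := by
    rw [← hper r hr' (-π)]
    congr 1
    ring
  have hwirtinger :=
    integral_sq_le_integral_deriv_sq_of_integral_eq_zero hWr1 hends (hmean r hr')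
  by_cases hint : IntervalIntegrable (fun θ => deriv (W₁ r) θ ^ 2 +
      Real.cos r ^ 2 * deriv (fun s => W₁ s θ) r ^ 2 - W₁ r θ ^ 2) MeasureTheory.volume (-π) π
  · have hd : IntervalIntegrable (fun θ => deriv (W₁ r) θ ^ 2) MeasureTheory.volume (-π) π :=
      (hWr1.continuous_deriv_one.pow 2).intervalIntegrable _ _
    have hw : IntervalIntegrable (fun θ => W₁ r θ ^ 2) MeasureTheory.volume (-π) π :=
      (hWr1.continuous.pow 2).intervalIntegrable _ _
    calc 0 ≤ ∫ θ in (-π)..π, (deriv (W₁ r) θ ^ 2 - W₁ r θ ^ 2) := by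
          rw [intervalIntegral.integral_sub hd hw]
          exact sub_nonneg.2 hwirtinger
      _ ≤ _ := intervalIntegral.integral_mono (by linarith [pi_pos]) (hd.sub hw) hint fun θ => by
          have := mul_nonneg (sq_nonneg (Real.cos r)) (sq_nonneg (deriv (fun s => W₁ s θ) r))
          dsimp only
          linarith
  · exact (intervalIntegral.integral_undef hint).ge
end

section
/- Let d > 0 and let c₁ : (−d, d) → ℝ be C¹ with c₁(r) > 0, extending continuously to [−d, d] with c₁(d) = 0. Let W₁, W₂ : (−d, d) × ℝ → ℝ be C¹, 2π-periodic in the second variable θ, with W₁ bounded, and suppose the divergence-free equation ∂_rW₁ + (c₁′(r)/c₁(r))·W₁ + ∂_θW₂ = 0 holds on (−d, d) × ℝ. Then ∫_{−π}^{π} W₁(r, θ) dθ = 0 for every r ∈ (−d, d). -/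
open Real Set

/-- Slices in the first variable of a function that is `C¹` on `U × ℝ` are differentiable. -/
lemma ContDiffOn.hasDerivAt_slice_left {f : ℝ → ℝ → ℝ} {U : Set ℝ} (hU : IsOpen U)
    (hf : ContDiffOn ℝ 1 (fun p : ℝ × ℝ => f p.1 p.2) (U ×ˢ univ)) {r : ℝ} (hr : r ∈ U) (θ : ℝ) :
    HasDerivAt (fun s => f s θ) (fderiv ℝ (fun p : ℝ × ℝ => f p.1 p.2) (r, θ) (1, 0)) r := by
  have hd : DifferentiableAt ℝ (fun p : ℝ × ℝ => f p.1 p.2) (r, θ) :=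
    (hf.contDiffAt ((hU.prod isOpen_univ).mem_nhds ⟨hr, mem_univ _⟩)).differentiableAt one_ne_zero
  exact hd.hasFDerivAt.comp_hasDerivAt (f := fun s => (s, θ)) r
    ((hasDerivAt_id r).prodMk (hasDerivAt_const r θ))

/-- Slices in the second variable of a function that is `C¹` on `U × ℝ` are differentiable. -/
lemma ContDiffOn.hasDerivAt_slice_right {f : ℝ → ℝ → ℝ} {U : Set ℝ} (hU : IsOpen U)
    (hf : ContDiffOn ℝ 1 (fun p : ℝ × ℝ => f p.1 p.2) (U ×ˢ univ)) {r : ℝ} (hr : r ∈ U) (θ : ℝ) :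
    HasDerivAt (f r) (fderiv ℝ (fun p : ℝ × ℝ => f p.1 p.2) (r, θ) (0, 1)) θ := by
  have hd : DifferentiableAt ℝ (fun p : ℝ × ℝ => f p.1 p.2) (r, θ) :=
    (hf.contDiffAt ((hU.prod isOpen_univ).mem_nhds ⟨hr, mem_univ _⟩)).differentiableAt one_ne_zero
  exact hd.hasFDerivAt.comp_hasDerivAt (f := fun t => (r, t)) θ
    ((hasDerivAt_const θ r).prodMk (hasDerivAt_id θ))

/-- The directional derivatives of a function that is `C¹` on `U × ℝ` are continuous there. -/
lemma ContDiffOn.continuousOn_fderiv_apply_strip {f : ℝ → ℝ → ℝ} {U : Set ℝ} (hU : IsOpen U)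
    (hf : ContDiffOn ℝ 1 (fun p : ℝ × ℝ => f p.1 p.2) (U ×ˢ univ)) (v : ℝ × ℝ) :
    ContinuousOn (fun q => fderiv ℝ (fun p : ℝ × ℝ => f p.1 p.2) q v) (U ×ˢ univ) :=
  (hf.continuousOn_fderiv_of_isOpen (hU.prod isOpen_univ) le_rfl).clm_apply continuousOn_const

/-- Restricting a function continuous on `U × ℝ` to a vertical line. -/
lemma ContinuousOn.continuous_vertical {g : ℝ × ℝ → ℝ} {U : Set ℝ}
    (hg : ContinuousOn g (U ×ˢ univ)) {r : ℝ} (hr : r ∈ U) : Continuous fun θ => g (r, θ) :=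
  hg.comp_continuous (by fun_prop) fun _ => ⟨hr, mem_univ _⟩

/-- Differentiation under the integral sign for a function that is `C¹` on `U × ℝ`. -/
lemma ContDiffOn.hasDerivAt_intervalIntegral {f : ℝ → ℝ → ℝ} {U : Set ℝ} (hU : IsOpen U)
    (hf : ContDiffOn ℝ 1 (fun p : ℝ × ℝ => f p.1 p.2) (U ×ˢ univ)) {r : ℝ} (hr : r ∈ U)
    (a b : ℝ) :
    HasDerivAt (fun s => ∫ θ in a..b, f s θ) (∫ θ in a..b, deriv (fun s => f s θ) r) r := by
  obtain ⟨ε, hε, hεU⟩ := Metric.nhds_basis_closedBall.mem_iff.1 (hU.mem_nhds hr)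
  have hcont := hf.continuousOn_fderiv_apply_strip hU (1, 0)
  obtain ⟨M, hM⟩ := ((isCompact_closedBall r ε).prod (isCompact_uIcc (a := a) (b := b)))
    |>.exists_bound_of_continuousOn (hcont.mono (prod_mono hεU (subset_univ _)))
  have hint (s : ℝ) (hs : s ∈ U) : Continuous (f s) :=
    hf.continuousOn.continuous_vertical hs
  have key := (intervalIntegral.hasDerivAt_integral_of_dominated_loc_of_deriv_le
    (μ := MeasureTheory.volume) (F := f) (bound := fun _ => M)
    (F' := fun s θ => fderiv ℝ (fun p : ℝ × ℝ => f p.1 p.2) (s, θ) (1, 0)) (a := a) (b := b)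
    (Metric.closedBall_mem_nhds r hε)
    (by filter_upwards [hU.mem_nhds hr] with s hs using (hint s hs).aestronglyMeasurable)
    ((hint r hr).intervalIntegrable a b)
    (hcont.continuous_vertical hr).aestronglyMeasurable
    (.of_forall fun θ hθ s hs => hM (s, θ) ⟨hs, uIoc_subset_uIcc hθ⟩)
    intervalIntegrable_const
    (.of_forall fun θ _ s hs => hf.hasDerivAt_slice_left hU (hεU hs) θ)).2
  simpa only [(hf.hasDerivAt_slice_left hU hr _).deriv] using key

/-- The integral of the derivative of a periodic function over a period vanishes. -/
lemma integral_deriv_eq_zero_of_periodic {f : ℝ → ℝ → ℝ} {U : Set ℝ} (hU : IsOpen U)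
    (hf : ContDiffOn ℝ 1 (fun p : ℝ × ℝ => f p.1 p.2) (U ×ˢ univ)) {r : ℝ} (hr : r ∈ U)
    (hper : Function.Periodic (f r) (2 * π)) : ∫ θ in (-π)..π, deriv (f r) θ = 0 := by
  have hderiv : deriv (f r) = _ := funext fun θ => (hf.hasDerivAt_slice_right hU hr θ).deriv
  rw [intervalIntegral.integral_deriv_eq_sub
    (fun θ _ => (hf.hasDerivAt_slice_right hU hr θ).differentiableAt)]
  · rw [← hper (-π), show -π + 2 * π = π by ring, sub_self]
  · rw [hderiv]
    exact ((hf.continuousOn_fderiv_apply_strip hU (0, 1)).continuous_vertical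
      hr).intervalIntegrable _ _

/-- On the surface of revolution with metric `dr² + c₁(r)²·dθ²`, any
divergence-free vector field `W = W₁∂_r + W₂∂_θ` (with `W₁` bounded, components
`2π`-periodic in `θ`) has zero angular mean: `∫_{-π}^{π} W₁(r,θ) dθ = 0` for every
`r ∈ (-d, d)`, provided `c₁ > 0` on `(-d, d)` extends continuously to `[-d, d]` with
`c₁(d) = 0`. -/
theorem divergence_free_zero_mean
    (d : ℝ) (hd : 0 < d) (c₁ : ℝ → ℝ) (W₁ W₂ : ℝ → ℝ → ℝ)
    (hc₁ : ContDiffOn ℝ 1 c₁ (Ioo (-d) d))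
    (hpos : ∀ r ∈ Ioo (-d) d, 0 < c₁ r)
    (hcont : ContinuousOn c₁ (Icc (-d) d))
    (hend : c₁ d = 0)
    (hW₁ : ContDiffOn ℝ 1 (fun p : ℝ × ℝ => W₁ p.1 p.2) ((Ioo (-d) d) ×ˢ (univ : Set ℝ)))
    (hW₂ : ContDiffOn ℝ 1 (fun p : ℝ × ℝ => W₂ p.1 p.2) ((Ioo (-d) d) ×ˢ (univ : Set ℝ)))
    (hper₁ : ∀ r ∈ Ioo (-d) d, ∀ θ : ℝ, W₁ r (θ + 2 * π) = W₁ r θ)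
    (hper₂ : ∀ r ∈ Ioo (-d) d, ∀ θ : ℝ, W₂ r (θ + 2 * π) = W₂ r θ)
    (hWb : ∃ C : ℝ, ∀ r ∈ Ioo (-d) d, ∀ θ : ℝ, |W₁ r θ| ≤ C)
    (hdiv : ∀ r ∈ Ioo (-d) d, ∀ θ : ℝ,
      deriv (fun s => W₁ s θ) r + (deriv c₁ r / c₁ r) * W₁ r θ + deriv (W₂ r) θ = 0) :
    ∀ r ∈ Ioo (-d) d, (∫ θ in (-π)..π, W₁ r θ) = 0 := by
  have hderiv : ∀ r ∈ Ioo (-d) d,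
      HasDerivAt (fun s => c₁ s * ∫ θ in (-π)..π, W₁ s θ) 0 r := by
    intro r hr
    have hc : HasDerivAt c₁ (deriv c₁ r) r :=
      ((hc₁.contDiffAt (isOpen_Ioo.mem_nhds hr)).differentiableAt one_ne_zero).hasDerivAt
    have hI : IntervalIntegrable (W₁ r) MeasureTheory.volume (-π) π :=
      (hW₁.continuousOn.continuous_vertical hr).intervalIntegrable _ _
    have hI₂ : IntervalIntegrable (deriv (W₂ r)) MeasureTheory.volume (-π) π := by
      rw [show deriv (W₂ r) = _ from
        funext fun θ => (hW₂.hasDerivAt_slice_right isOpen_Ioo hr θ).deriv]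
      exact ((hW₂.continuousOn_fderiv_apply_strip isOpen_Ioo (0, 1)).continuous_vertical
        hr).intervalIntegrable _ _
    have hmean : ∫ θ in (-π)..π, deriv (fun s => W₁ s θ) r
        = -(deriv c₁ r / c₁ r) * ∫ θ in (-π)..π, W₁ r θ := by
      have heq (θ : ℝ) : deriv (fun s => W₁ s θ) r
          = -(deriv c₁ r / c₁ r) * W₁ r θ - deriv (W₂ r) θ := by linarith [hdiv r hr θ]
      simp only [heq]
      rw [intervalIntegral.integral_sub (hI.const_mul _) hI₂, intervalIntegral.integral_const_mul,
        integral_deriv_eq_zero_of_periodic isOpen_Ioo hW₂ hr (hper₂ r hr), sub_zero]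
    refine (hc.mul (hW₁.hasDerivAt_intervalIntegral isOpen_Ioo hr (-π) π)).congr_deriv ?_
    rw [hmean]
    have := (hpos r hr).ne'
    field_simp
    ring
  obtain ⟨C, hC⟩ := hWb
  intro r hr
  have hconst : ∀ s ∈ Ioo (-d) d,
      (c₁ s * ∫ θ in (-π)..π, W₁ s θ) = c₁ r * ∫ θ in (-π)..π, W₁ r θ := fun s hs =>
    isOpen_Ioo.is_const_of_deriv_eq_zero isPreconnected_Ioo
      (fun x hx => (hderiv x hx).differentiableAt.differentiableWithinAt)
      (fun x hx => (hderiv x hx).deriv) hs hr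
  have hbound : ∀ s ∈ Ioo (-d) d,
      |c₁ r * ∫ θ in (-π)..π, W₁ r θ| ≤ c₁ s * (C * |π - -π|) := by
    intro s hs
    rw [← hconst s hs, abs_mul, abs_of_pos (hpos s hs)]
    have hnorm : ‖∫ θ in (-π)..π, W₁ s θ‖ ≤ C * |π - -π| :=
      intervalIntegral.norm_integral_le_of_norm_le_const fun θ _ => hC s hs θ
    exact mul_le_mul_of_nonneg_left hnorm (hpos s hs).le
  have hlim : Filter.Tendsto c₁ (nhdsWithin d (Ioo (-d) d)) (nhds 0) :=
    hend ▸ (hcont d ⟨by linarith, le_rfl⟩).mono_left (nhdsWithin_mono _ Ioo_subset_Icc_self)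
  have : (nhdsWithin d (Ioo (-d) d)).NeBot := right_nhdsWithin_Ioo_neBot (by linarith)
  have hzero : |c₁ r * ∫ θ in (-π)..π, W₁ r θ| ≤ 0 := by
    have h := hlim.mul_const (C * |π - -π|)
    rw [zero_mul] at h
    exact ge_of_tendsto h (Filter.eventually_of_mem self_mem_nhdsWithin hbound)
  exact (mul_eq_zero.1 (abs_nonpos_iff.1 hzero)).resolve_left (hpos r hr).ne'
end

section
/- Let d > 0, let c₁ : (−d, d) → ℝ be smooth and positive, let F : (−d, d) → ℝ be smooth with compact support contained in (−d, d), and let W₁, W₂ : (−d, d) × ℝ → ℝ be C², 2π-periodic in θ, and divergence-free: ∂_rW₁ + (c₁′/c₁)·W₁ + ∂_θW₂ = 0. Set V = F(r)∂_θ and W = W₁∂_r + W₂∂_θ. Then ∫_{−d}^{d} ∫_{−π}^{π} ( A₁·W₁ + c₁²·A₂·W₂ )·c₁ dθ dr = ∫_{−d}^{d} ∫_{−π}^{π} F²·c₁·( −(∂_θW₁)² − c₁²·(∂_rW₁)² + ((c₁′)² − c₁·c₁″)·W₁² ) dθ dr, where (A₁, A₂) are the components of ∇_V[V,W] + ∇_{[V,W]}V,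 namely A₁ = F²·(∂_θ²W₁ − 2c₁c₁′·∂_θW₂) + 2c₁c₁′·F·F′·W₁ and A₂ = F²·(∂_θ²W₂ + (2c₁′/c₁)·∂_θW₁). In other words, the Misiołek curvature MC_{V,W} := (∇_V[V,W] + ∇_{[V,W]}V, W) equals the right-hand side. -/
open Real Set

open MeasureTheory Topology

/-- A function that is continuous on `U × ℝ` and vanishes wherever `F` vanishes in the first
variable is continuous, provided the support of `F` lies in the open set `U`. -/
theorem continuous_of_continuousOn_of_tsupport_subset {f : ℝ × ℝ → ℝ} {F : ℝ → ℝ} {U : Set ℝ}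
    (hU : IsOpen U) (hFU : tsupport F ⊆ U) (hf : ContinuousOn f (U ×ˢ univ))
    (h0 : ∀ p, F p.1 = 0 → f p = 0) : Continuous f := by
  rw [continuous_iff_continuousAt]
  intro p
  by_cases hp : p.1 ∈ U
  · exact hf.continuousAt ((hU.prod isOpen_univ).mem_nhds ⟨hp, mem_univ _⟩)
  · have hF : ∀ᶠ q in 𝓝 p, F q.1 = 0 :=
      continuous_fst.continuousAt.eventually
        (notMem_tsupport_iff_eventuallyEq.1 fun h => hp (hFU h))
    exact continuousAt_const.congr (hF.mono fun q hq => (h0 q hq).symm)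

section Slices

variable {W : ℝ → ℝ → ℝ} {U : Set ℝ} {n : WithTop ℕ∞}

theorem ContDiffOn.contDiff_slice_right
    (hW : ContDiffOn ℝ n (fun p : ℝ × ℝ => W p.1 p.2) (U ×ˢ univ)) {r : ℝ} (hr : r ∈ U) :
    ContDiff ℝ n (W r) :=
  contDiffOn_univ.1 <| hW.comp (f := fun θ : ℝ => (r, θ)) (by fun_prop)
    fun _ _ => ⟨hr, mem_univ _⟩

theorem ContDiffOn.contDiffOn_slice_left
    (hW : ContDiffOn ℝ n (fun p : ℝ × ℝ => W p.1 p.2) (U ×ˢ univ)) (θ : ℝ) :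
    ContDiffOn ℝ n (fun s => W s θ) U :=
  hW.comp (f := fun s : ℝ => (s, θ)) (by fun_prop) fun _ hs => ⟨hs, mem_univ _⟩

theorem ContDiffOn.continuousOn_deriv_slice_right (hU : IsOpen U) (hn : 1 ≤ n)
    (hW : ContDiffOn ℝ n (fun p : ℝ × ℝ => W p.1 p.2) (U ×ˢ univ)) :
    ContinuousOn (fun p : ℝ × ℝ => deriv (W p.1) p.2) (U ×ˢ univ) := by
  have hO : IsOpen (U ×ˢ (univ : Set ℝ)) := hU.prod isOpen_univ
  refine ((hW.continuousOn_fderiv_of_isOpen hO hn).clm_apply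
    (continuousOn_const (c := ((0 : ℝ), (1 : ℝ))))).congr fun p hp => ?_
  have hd := ((hW.contDiffAt (hO.mem_nhds hp)).differentiableAt
    (zero_lt_one.trans_le hn).ne').hasFDerivAt
  exact (hd.comp_hasDerivAt (f := fun θ : ℝ => (p.1, θ)) p.2
    ((hasDerivAt_const p.2 p.1).prodMk (hasDerivAt_id p.2))).deriv

theorem ContDiffOn.continuousOn_deriv_slice_left (hU : IsOpen U) (hn : 1 ≤ n)
    (hW : ContDiffOn ℝ n (fun p : ℝ × ℝ => W p.1 p.2) (U ×ˢ univ)) :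
    ContinuousOn (fun p : ℝ × ℝ => deriv (fun s => W s p.2) p.1) (U ×ˢ univ) := by
  have hO : IsOpen (U ×ˢ (univ : Set ℝ)) := hU.prod isOpen_univ
  refine ((hW.continuousOn_fderiv_of_isOpen hO hn).clm_apply
    (continuousOn_const (c := ((1 : ℝ), (0 : ℝ))))).congr fun p hp => ?_
  have hd := ((hW.contDiffAt (hO.mem_nhds hp)).differentiableAt
    (zero_lt_one.trans_le hn).ne').hasFDerivAt
  exact (hd.comp_hasDerivAt (f := fun s : ℝ => (s, p.2)) p.1
    ((hasDerivAt_id p.1).prodMk (hasDerivAt_const p.1 p.2))).deriv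

end Slices

theorem deriv_add_period {u : ℝ → ℝ} {T : ℝ} (hu : ∀ x, u (x + T) = u x) (x : ℝ) :
    deriv u (x + T) = deriv u x := by
  rw [← deriv_comp_add_const, funext hu]

/-- The derivative of a smooth periodic expression in `u`, `v` and their first derivatives
integrates to zero over a period. -/
theorem integral_deriv_periodic_quadratic_eq_zero {u v : ℝ → ℝ} (hu : ContDiff ℝ 2 u)
    (hv : ContDiff ℝ 2 v) (hup : ∀ θ, u (θ + 2 * π) = u θ) (hvp : ∀ θ, v (θ + 2 * π) = v θ)
    (α β γ : ℝ) :
    ∫ θ in (-π)..π, (α * (deriv u θ * deriv u θ + u θ * deriv (deriv u) θ)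
        + β * (deriv v θ * deriv v θ + v θ * deriv (deriv v) θ)
        + γ * (deriv u θ * v θ + u θ * deriv v θ)) = 0 := by
  have hu' : ContDiff ℝ 1 (deriv u) := hu.deriv'
  have hv' : ContDiff ℝ 1 (deriv v) := hv.deriv'
  have hu'' : Continuous (deriv (deriv u)) := hu'.continuous_deriv le_rfl
  have hv'' : Continuous (deriv (deriv v)) := hv'.continuous_deriv le_rfl
  have hcu := hu.continuous
  have hcv := hv.continuous
  have hcu' := hu'.continuous
  have hcv' := hv'.continuous
  have key : ∀ θ, HasDerivAt (fun θ => α * (u θ * deriv u θ) + β * (v θ * deriv v θ)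
      + γ * (u θ * v θ)) (α * (deriv u θ * deriv u θ + u θ * deriv (deriv u) θ)
        + β * (deriv v θ * deriv v θ + v θ * deriv (deriv v) θ)
        + γ * (deriv u θ * v θ + u θ * deriv v θ)) θ := by
    intro θ
    have h1 := (hu.differentiable two_ne_zero θ).hasDerivAt
    have h2 := (hv.differentiable two_ne_zero θ).hasDerivAt
    have h3 := (hu'.differentiable one_ne_zero θ).hasDerivAt
    have h4 := (hv'.differentiable one_ne_zero θ).hasDerivAt
    exact (((h1.mul h3).const_mul α).add ((h2.mul h4).const_mul β)).add ((h1.mul h2).const_mul γ)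
  rw [intervalIntegral.integral_eq_sub_of_hasDerivAt (fun θ _ => key θ)
    (Continuous.intervalIntegrable (by fun_prop) _ _)]
  have hπ : π = -π + 2 * π := by ring
  have e1 : u π = u (-π) := by rw [← hup (-π), ← hπ]
  have e2 : v π = v (-π) := by rw [← hvp (-π), ← hπ]
  have e3 : deriv u π = deriv u (-π) := by rw [← deriv_add_period hup (-π), ← hπ]
  have e4 : deriv v π = deriv v (-π) := by rw [← deriv_add_period hvp (-π), ← hπ]
  rw [e1, e2, e3, e4, sub_self]

/-- On the surface of revolution with metric `dr² + c₁(r)²·dθ²`, for a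
zonal flow `V = F(r)∂_θ` (with `F` smooth, compactly supported in `(-d,d)`) and a
divergence-free field `W = W₁∂_r + W₂∂_θ`, the Misiołek curvature
`MC_{V,W} = (∇_V[V,W] + ∇_{[V,W]}V, W)`, whose integrand is
`(A₁·W₁ + c₁²·A₂·W₂)·c₁` with `A₁ = F²(∂_θ²W₁ - 2c₁c₁′∂_θW₂) + 2c₁c₁′FF′W₁` and
`A₂ = F²(∂_θ²W₂ + (2c₁′/c₁)∂_θW₁)`, equals
`∫∫ F²·c₁·(-(∂_θW₁)² - c₁²(∂_rW₁)² + ((c₁′)² - c₁c₁″)·W₁²) dθ dr`. -/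
theorem misiolek_curvature_formula
    (d : ℝ) (hd : 0 < d) (c₁ F : ℝ → ℝ) (W₁ W₂ : ℝ → ℝ → ℝ)
    (hc₁ : ContDiffOn ℝ (⊤ : ℕ∞) c₁ (Ioo (-d) d))
    (hpos : ∀ r ∈ Ioo (-d) d, 0 < c₁ r)
    (hF : ContDiff ℝ (⊤ : ℕ∞) F) (hFsupp : HasCompactSupport F)
    (hFsub : tsupport F ⊆ Ioo (-d) d)
    (hW₁ : ContDiffOn ℝ 2 (fun p : ℝ × ℝ => W₁ p.1 p.2) ((Ioo (-d) d) ×ˢ (univ : Set ℝ)))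
    (hW₂ : ContDiffOn ℝ 2 (fun p : ℝ × ℝ => W₂ p.1 p.2) ((Ioo (-d) d) ×ˢ (univ : Set ℝ)))
    (hper₁ : ∀ r ∈ Ioo (-d) d, ∀ θ : ℝ, W₁ r (θ + 2 * π) = W₁ r θ)
    (hper₂ : ∀ r ∈ Ioo (-d) d, ∀ θ : ℝ, W₂ r (θ + 2 * π) = W₂ r θ)
    (hdiv : ∀ r ∈ Ioo (-d) d, ∀ θ : ℝ,
      deriv (fun s => W₁ s θ) r + (deriv c₁ r / c₁ r) * W₁ r θ + deriv (W₂ r) θ = 0) :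
    (∫ r in (-d)..d, ∫ θ in (-π)..π,
        ((F r ^ 2 * (deriv (deriv (W₁ r)) θ - 2 * c₁ r * deriv c₁ r * deriv (W₂ r) θ)
            + 2 * c₁ r * deriv c₁ r * F r * deriv F r * W₁ r θ) * W₁ r θ
          + (c₁ r) ^ 2
            * (F r ^ 2 * (deriv (deriv (W₂ r)) θ + 2 * deriv c₁ r / c₁ r * deriv (W₁ r) θ))
            * W₂ r θ) * c₁ r)
      = ∫ r in (-d)..d, ∫ θ in (-π)..π,
          F r ^ 2 * c₁ r *
            (-(deriv (W₁ r) θ) ^ 2 - (c₁ r) ^ 2 * (deriv (fun s => W₁ s θ) r) ^ 2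
              + ((deriv c₁ r) ^ 2 - c₁ r * deriv (deriv c₁) r) * (W₁ r θ) ^ 2) := by
  have hI : IsOpen (Ioo (-d) d) := isOpen_Ioo
  have hc' : ContDiffOn ℝ (⊤ : ℕ∞) (deriv c₁) (Ioo (-d) d) := hc₁.deriv_of_isOpen hI (by simp)
  have hc'' : ContDiffOn ℝ (⊤ : ℕ∞) (deriv (deriv c₁)) (Ioo (-d) d) :=
    hc'.deriv_of_isOpen hI (by simp)
  have hF0 : ∀ r ∉ Ioo (-d) d, F r = 0 := fun r hr =>
    image_eq_zero_of_notMem_tsupport fun h => hr (hFsub h)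
  have hmaps : MapsTo Prod.fst (Ioo (-d) d ×ˢ (univ : Set ℝ)) (Ioo (-d) d) := fun _ h => h.1
  have kc := hc₁.continuousOn.comp continuousOn_fst hmaps
  have kc' := hc'.continuousOn.comp continuousOn_fst hmaps
  have kc'' := hc''.continuousOn.comp continuousOn_fst hmaps
  have kF := (hF.continuous.comp continuous_fst).continuousOn (s := Ioo (-d) d ×ˢ (univ : Set ℝ))
  have kF' := ((hF.continuous_deriv (by simp)).comp continuous_fst).continuousOn
    (s := Ioo (-d) d ×ˢ (univ : Set ℝ))
  have kW := hW₁.continuousOn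
  have kWθ := hW₁.continuousOn_deriv_slice_right hI (by norm_num)
  have kWr := hW₁.continuousOn_deriv_slice_left hI (by norm_num)
  simp only [Function.comp_def] at kc kc' kc'' kF kF'
  let R : ℝ → ℝ → ℝ := fun r θ => F r ^ 2 * c₁ r *
    (-(deriv (W₁ r) θ) ^ 2 - (c₁ r) ^ 2 * (deriv (fun s => W₁ s θ) r) ^ 2
      + ((deriv c₁ r) ^ 2 - c₁ r * deriv (deriv c₁) r) * (W₁ r θ) ^ 2)
  -- the `r`-derivative of `c₁² c₁′ F² W₁²`
  let D : ℝ → ℝ → ℝ := fun r θ =>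
    (2 * c₁ r * deriv c₁ r * deriv c₁ r + c₁ r ^ 2 * deriv (deriv c₁) r) * (F r ^ 2 * W₁ r θ ^ 2)
      + c₁ r ^ 2 * deriv c₁ r * (2 * F r * deriv F r * W₁ r θ ^ 2
        + F r ^ 2 * (2 * W₁ r θ * deriv (fun s => W₁ s θ) r))
  have hR : Continuous R.uncurry := by
    refine continuous_of_continuousOn_of_tsupport_subset hI hFsub ?_ ?_
    · exact ((kF.pow 2).mul kc).mul (((kWθ.pow 2).neg.sub ((kc.pow 2).mul (kWr.pow 2))).add
        (((kc'.pow 2).sub (kc.mul kc'')).mul (kW.pow 2)))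
    · intro p hp
      simp [R, Function.uncurry_def, hp]
  have hD : Continuous D.uncurry := by
    refine continuous_of_continuousOn_of_tsupport_subset hI hFsub ?_ ?_
    · exact (((((continuousOn_const.mul kc).mul kc').mul kc').add ((kc.pow 2).mul kc'')).mul
        ((kF.pow 2).mul (kW.pow 2))).add (((kc.pow 2).mul kc').mul
          ((((continuousOn_const.mul kF).mul kF').mul (kW.pow 2)).add
            ((kF.pow 2).mul ((continuousOn_const.mul kW).mul kWr))))
    · intro p hp
      simp [D, Function.uncurry_def, hp]
  have hRr : ∀ r, Continuous (R r) := fun r => hR.comp (by fun_prop : Continuous fun θ => (r, θ))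
  have hDr : ∀ r, Continuous (D r) := fun r => hD.comp (by fun_prop : Continuous fun θ => (r, θ))
  have hDθ : ∀ θ, Continuous fun r => D r θ := fun θ =>
    hD.comp (by fun_prop : Continuous fun r => (r, θ))
  have hD0 : ∫ r in (-d)..d, ∫ θ in (-π)..π, D r θ = 0 := by
    rw [intervalIntegral_intervalIntegral_swap]
    · refine (intervalIntegral.integral_congr fun θ _ => ?_).trans
        intervalIntegral.integral_zero
      have hderiv : ∀ r, HasDerivAt
          (fun r => c₁ r ^ 2 * deriv c₁ r * (F r ^ 2 * W₁ r θ ^ 2)) (D r θ) r := by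
        intro r
        by_cases hr : r ∈ Ioo (-d) d
        · have hn := hI.mem_nhds hr
          have h1 := ((hc₁.contDiffAt hn).differentiableAt (by simp)).hasDerivAt
          have h2 := ((hc'.contDiffAt hn).differentiableAt (by simp)).hasDerivAt
          have h3 := (hF.differentiable (by simp) r).hasDerivAt
          have h4 := (((hW₁.contDiffOn_slice_left θ).contDiffAt hn).differentiableAt
            two_ne_zero).hasDerivAt
          refine (((h1.pow 2).mul h2).mul ((h3.pow 2).mul (h4.pow 2))).congr_deriv ?_
          simp only [D, Pi.mul_apply, Pi.pow_apply]
          norm_num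
        · have hev := notMem_tsupport_iff_eventuallyEq.1 fun h => hr (hFsub h)
          have hz : D r θ = 0 := by simp [D, hF0 r hr]
          rw [hz]
          refine (hasDerivAt_const r (0 : ℝ)).congr_of_eventuallyEq (hev.mono fun s hs => ?_)
          simp [hs]
      rw [intervalIntegral.integral_eq_sub_of_hasDerivAt (fun r _ => hderiv r)
        ((hDθ θ).intervalIntegrable _ _)]
      simp [hF0 d (by simp), hF0 (-d) (by simp)]
    · exact (hD.continuousOn.integrableOn_compact
        (isCompact_uIcc.prod isCompact_uIcc)).mono_set
          (prod_mono uIoc_subset_uIcc uIoc_subset_uIcc)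
  have inner : ∀ r, (∫ θ in (-π)..π,
        ((F r ^ 2 * (deriv (deriv (W₁ r)) θ - 2 * c₁ r * deriv c₁ r * deriv (W₂ r) θ)
            + 2 * c₁ r * deriv c₁ r * F r * deriv F r * W₁ r θ) * W₁ r θ
          + (c₁ r) ^ 2
            * (F r ^ 2 * (deriv (deriv (W₂ r)) θ + 2 * deriv c₁ r / c₁ r * deriv (W₁ r) θ))
            * W₂ r θ) * c₁ r)
      = (∫ θ in (-π)..π, R r θ) + ∫ θ in (-π)..π, D r θ := by
    intro r
    by_cases hr : r ∈ Ioo (-d) d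
    · have hu := hW₁.contDiff_slice_right hr
      have hv := hW₂.contDiff_slice_right hr
      have hu' : ContDiff ℝ 1 (deriv (W₁ r)) := hu.deriv'
      have hv' : ContDiff ℝ 1 (deriv (W₂ r)) := hv.deriv'
      have hu'' := hu'.continuous_deriv le_rfl
      have hv'' := hv'.continuous_deriv le_rfl
      have hcu := hu.continuous
      have hcv := hv.continuous
      have hcu' := hu'.continuous
      have hcv' := hv'.continuous
      have hcr := (hpos r hr).ne'
      rw [← intervalIntegral.integral_add ((hRr r).intervalIntegrable _ _)
        ((hDr r).intervalIntegrable _ _), ← sub_eq_zero, ← intervalIntegral.integral_sub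
        (Continuous.intervalIntegrable (by fun_prop) _ _)
        (Continuous.intervalIntegrable (by fun_prop) _ _),
        ← integral_deriv_periodic_quadratic_eq_zero hu hv (hper₁ r hr) (hper₂ r hr)
        (F r ^ 2 * c₁ r) (F r ^ 2 * c₁ r ^ 3) (2 * c₁ r ^ 2 * deriv c₁ r * F r ^ 2)]
      refine intervalIntegral.integral_congr fun θ _ => ?_
      have hdv : deriv (fun s => W₁ s θ) r
          = -(deriv c₁ r / c₁ r * W₁ r θ) - deriv (W₂ r) θ := by
        linarith [hdiv r hr θ]
      simp only [R, D, hdv]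
      field_simp
      ring
    · simp [R, D, hF0 r hr]
  simp only [inner]
  rw [intervalIntegral.integral_add
    ((intervalIntegral.continuous_parametric_intervalIntegral_of_continuous' hR _ _).intervalIntegrable
      _ _)
    ((intervalIntegral.continuous_parametric_intervalIntegral_of_continuous' hD _ _).intervalIntegrable
      _ _), hD0, add_zero]
end

section
/- Let d > 0 and let c₁ : (−d, d) → ℝ be smooth and positive with c₁′(r)² − c₁(r)·c₁″(r) > 1 for all r ∈ (−d, d). Let F : (−d, d) → ℝ be smooth, not identically zero, with compact support contained in (−d, d). Then there exists a smooth function h : (−d, d) → ℝ with compact support such that ∫_{−d}^{d} F(r)²·c₁(r)·( h(r)²·(c₁′(r)² − c₁(r)·c₁″(r) − 1) − c₁(r)²·h′(r)² ) dr > 0. -/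
open Real Set

/-- If `c₁ > 0` satisfies `(c₁′)² - c₁·c₁″ > 1` on `(-d, d)` and `F` is a
smooth function, not identically zero, compactly supported in `(-d, d)`, then there is
a smooth compactly supported `h` making the integral
`∫ F²·c₁·(h²·((c₁′)² - c₁c₁″ - 1) - c₁²·(h′)²) dr` positive (i.e. `MC_{V,W₀} > 0` for
the test field `W₀` built from `h`). -/
theorem exists_test_function_positive_integral
    (d : ℝ) (hd : 0 < d) (c₁ F : ℝ → ℝ)
    (hc₁ : ContDiffOn ℝ (⊤ : ℕ∞) c₁ (Ioo (-d) d))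
    (hpos : ∀ r ∈ Ioo (-d) d, 0 < c₁ r)
    (hcurv : ∀ r ∈ Ioo (-d) d, 1 < (deriv c₁ r) ^ 2 - c₁ r * deriv (deriv c₁) r)
    (hF : ContDiff ℝ (⊤ : ℕ∞) F) (hFsupp : HasCompactSupport F)
    (hFsub : tsupport F ⊆ Ioo (-d) d)
    (hFne : ∃ r, F r ≠ 0) :
    ∃ h : ℝ → ℝ, ContDiff ℝ (⊤ : ℕ∞) h ∧ HasCompactSupport h ∧ tsupport h ⊆ Ioo (-d) d ∧
      0 < ∫ r in (-d)..d,
        F r ^ 2 * c₁ r *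
          ((h r) ^ 2 * ((deriv c₁ r) ^ 2 - c₁ r * deriv (deriv c₁) r - 1)
            - (c₁ r) ^ 2 * (deriv h r) ^ 2) := by
  have hball : Metric.ball (0 : ℝ) d = Ioo (-d) d := by
    rw [Real.ball_eq_Ioo, zero_sub, zero_add]
  obtain ⟨R, ⟨hR0, hRd⟩, hFR⟩ :=
    exists_pos_lt_subset_ball hd (isClosed_tsupport F) (hball ▸ hFsub)
  let h : ContDiffBump (0 : ℝ) := ⟨R, (R + d) / 2, hR0, by linarith⟩
  have hone : ∀ r, F r ≠ 0 → h =ᶠ[nhds r] 1 := fun r hr ↦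
    h.eventuallyEq_one_of_mem_ball (hFR (subset_tsupport F hr))
  refine ⟨h, h.contDiff, h.hasCompactSupport, ?_, ?_⟩
  · rw [h.tsupport_eq, ← hball]
    exact Metric.closedBall_subset_ball (show (R + d) / 2 < d by linarith)
  have hc₁' : ContDiffOn ℝ (⊤ : ℕ∞) (deriv c₁) (Ioo (-d) d) :=
    hc₁.deriv_of_isOpen isOpen_Ioo (by simp)
  have hc₁'' : ContDiffOn ℝ (⊤ : ℕ∞) (deriv (deriv c₁)) (Ioo (-d) d) :=
    hc₁'.deriv_of_isOpen isOpen_Ioo (by simp)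
  have hposF : ∀ r, F r ≠ 0 → 0 < F r ^ 2 * c₁ r *
      ((h r) ^ 2 * ((deriv c₁ r) ^ 2 - c₁ r * deriv (deriv c₁) r - 1)
        - (c₁ r) ^ 2 * (deriv h r) ^ 2) := by
    intro r hr
    have hmem : r ∈ Ioo (-d) d := hFsub (subset_tsupport F hr)
    have h1 : h r = 1 := (hone r hr).eq_of_nhds
    have h2 : deriv h r = 0 := by
      rw [(hone r hr).deriv_eq]
      exact deriv_const r 1
    have h3 := hpos r hmem
    have h4 := hcurv r hmem
    rw [h1, h2]
    have h5 : 0 < (1 : ℝ) ^ 2 * ((deriv c₁ r) ^ 2 - c₁ r * deriv (deriv c₁) r - 1)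
        - (c₁ r) ^ 2 * 0 ^ 2 := by linarith
    positivity
  obtain ⟨r₀, hr₀⟩ := hFne
  refine intervalIntegral.integral_pos (by linarith) (Continuous.continuousOn ?_) ?_
    ⟨r₀, Ioo_subset_Icc_self (hFsub (subset_tsupport F hr₀)), hposF r₀ hr₀⟩
  · rw [continuous_iff_continuousAt]
    intro r
    by_cases hr : r ∈ tsupport F
    · have hnhds : Ioo (-d) d ∈ nhds r := isOpen_Ioo.mem_nhds (hFsub hr)
      have h0 := hc₁.continuousOn.continuousAt hnhds
      have h1 := hc₁'.continuousOn.continuousAt hnhds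
      have h2 := hc₁''.continuousOn.continuousAt hnhds
      have h3 : ContinuousAt F r := hF.continuous.continuousAt
      have h4 : ContinuousAt h r := h.continuous.continuousAt
      have h5 : ContinuousAt (deriv h) r :=
        ((h.contDiff (n := 1)).continuous_deriv le_rfl).continuousAt
      fun_prop
    · refine (continuousAt_const (y := (0 : ℝ))).congr ?_
      filter_upwards [notMem_tsupport_iff_eventuallyEq.mp hr] with x hx
      simp [hx]
  · intro r _
    by_cases hr : F r = 0
    · simp [hr]
    · exact (hposF r hr).le
end

section
/- Let a > 1, d > 0, and let c₁, c₂ : (−d, d) → ℝ be smooth functions with c₁(r) > 0, c₁(r)² = a²(1 − c₂(r)²), c₁′(r)² + c₂′(r)² = 1 and c₂′(r) > 0 for all r ∈ (−d, d). Let F : (−d, d) → ℝ be smooth, not identically zero, with compact support contained in (−d, d). Then there exist functions W₁, W₂ : (−d, d) × ℝ → ℝ, smooth, 2π-periodic in θ, with compact support in the r-variable, satisfying the divergence-free equation ∂_rW₁ + (c₁′/c₁)·W₁ + ∂_θW₂ = 0, such that ∫_{−d}^{d} ∫_{−π}^{π} F²·c₁·( −(∂_θW₁)² − c₁²·(∂_rW₁)²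 + ((c₁′)² − c₁·c₁″)·W₁² ) dθ dr > 0. In other words, every zonal flow V = F(r)∂_θ on the ellipsoid of revolution x² + y² = a²(1 − z²) with a > 1, supported away from the poles, admits a divergence-free W with positive Misiołek curvature MC_{V,W} > 0. -/
open Real Set

/-- If a curve `(c, z)` of unit speed with `z' > 0` runs in the right half of the ellipse
`x² = a²(1 - z²)` with `a > 1`, then `(c')² - c c'' > 1`. The numbers `p, q, P, Q` are the first and
second derivatives of `c` and `z`; the hypotheses are the differentiated curve equations. -/
lemma one_lt_of_ellipse_relations {a c z p q P Q : ℝ} (ha : 1 < a) (hc : 0 < c) (hq : 0 < q)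
    (hpq : p ^ 2 + q ^ 2 = 1) (h₁ : c * p = -(a ^ 2 * (z * q)))
    (h₂ : p ^ 2 + c * P = -(a ^ 2 * (q ^ 2 + z * Q))) (h₃ : p * P + q * Q = 0) :
    1 < p ^ 2 - c * P := by
  have hP : P * (c ^ 2 + a ^ 4 * z ^ 2) = -(c * (p ^ 2 + a ^ 2 * q ^ 2)) := by
    apply mul_left_cancel₀ hq.ne'
    linear_combination c * q * h₂ + (a ^ 2 * z * P) * h₁ - a ^ 2 * z * c * h₃
  have hsq : c ^ 2 * p ^ 2 = a ^ 4 * z ^ 2 * q ^ 2 := by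
    linear_combination (c * p - a ^ 2 * (z * q)) * h₁
  have hD : 0 < c ^ 2 + a ^ 4 * z ^ 2 := by positivity
  have key : (c ^ 2 + a ^ 4 * z ^ 2) * (p ^ 2 - c * P - 1) = (a ^ 2 - 1) * (c ^ 2 * q ^ 2) := by
    linear_combination (-c) * hP + (c ^ 2 + a ^ 4 * z ^ 2) * hpq + hsq
  have ha' : 0 < a ^ 2 - 1 := by nlinarith
  have : 0 < (c ^ 2 + a ^ 4 * z ^ 2) * (p ^ 2 - c * P - 1) := by rw [key]; positivity
  linarith [pos_of_mul_pos_right this hD.le]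

/-- The first and second derivatives of a smooth function on an open set, as `HasDerivAt`. -/
lemma hasDerivAt_and_hasDerivAt_deriv {f : ℝ → ℝ} {s : Set ℝ} (hs : IsOpen s)
    (hf : ContDiffOn ℝ (⊤ : ℕ∞) f s) {r : ℝ} (hr : r ∈ s) :
    HasDerivAt f (deriv f r) r ∧ HasDerivAt (deriv f) (deriv (deriv f) r) r := by
  have hf' : ContDiffOn ℝ (⊤ : ℕ∞) (deriv f) s := hf.deriv_of_isOpen hs (by simp)
  exact ⟨((hf.contDiffAt (hs.mem_nhds hr)).differentiableAt (by simp)).hasDerivAt,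
    ((hf'.contDiffAt (hs.mem_nhds hr)).differentiableAt (by simp)).hasDerivAt⟩

/-- Along a unit speed parametrization of the right half of the ellipse `x² = a²(1 - z²)`, `a > 1`,
one has `(c₁')² - c₁ c₁'' > 1`. -/
lemma one_lt_deriv_sq_sub_mul_deriv_deriv {a : ℝ} (ha : 1 < a) {c₁ c₂ : ℝ → ℝ} {s : Set ℝ}
    (hs : IsOpen s) (hc₁ : ContDiffOn ℝ (⊤ : ℕ∞) c₁ s) (hc₂ : ContDiffOn ℝ (⊤ : ℕ∞) c₂ s)
    (hpos : ∀ r ∈ s, 0 < c₁ r) (hell : ∀ r ∈ s, (c₁ r) ^ 2 = a ^ 2 * (1 - (c₂ r) ^ 2))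
    (harc : ∀ r ∈ s, (deriv c₁ r) ^ 2 + (deriv c₂ r) ^ 2 = 1)
    (hmono : ∀ r ∈ s, 0 < deriv c₂ r) {r : ℝ} (hr : r ∈ s) :
    1 < (deriv c₁ r) ^ 2 - c₁ r * deriv (deriv c₁) r := by
  have hfirst : ∀ t ∈ s, c₁ t * deriv c₁ t = -(a ^ 2 * (c₂ t * deriv c₂ t)) := by
    intro t ht
    have h₁ := (hasDerivAt_and_hasDerivAt_deriv hs hc₁ ht).1.pow 2
    have h₂ := (((hasDerivAt_and_hasDerivAt_deriv hs hc₂ ht).1.pow 2).const_sub 1).const_mul (a ^ 2)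
    have heq : (c₁ ^ 2) =ᶠ[nhds t] fun x => a ^ 2 * (1 - (c₂ ^ 2) x) := by
      filter_upwards [hs.mem_nhds ht] with x hx using hell x hx
    have := h₁.unique (h₂.congr_of_eventuallyEq heq)
    norm_num at this
    linarith
  obtain ⟨d₁, e₁⟩ := hasDerivAt_and_hasDerivAt_deriv hs hc₁ hr
  obtain ⟨d₂, e₂⟩ := hasDerivAt_and_hasDerivAt_deriv hs hc₂ hr
  refine one_lt_of_ellipse_relations (z := c₂ r) (Q := deriv (deriv c₂) r) ha (hpos r hr)
    (hmono r hr) (harc r hr) (hfirst r hr) ?_ ?_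
  · have heq : (c₁ * deriv c₁) =ᶠ[nhds r] -fun x => a ^ 2 * (c₂ * deriv c₂) x := by
      filter_upwards [hs.mem_nhds hr] with x hx using hfirst x hx
    have := (d₁.mul e₁).unique ((((d₂.mul e₂).const_mul (a ^ 2)).neg).congr_of_eventuallyEq heq)
    linear_combination this
  · have heq : (deriv c₁ ^ 2 + deriv c₂ ^ 2) =ᶠ[nhds r] fun _ => (1 : ℝ) := by
      filter_upwards [hs.mem_nhds hr] with x hx using harc x hx
    have := ((e₁.pow 2).add (e₂.pow 2)).unique ((hasDerivAt_const r (1 : ℝ)).congr_of_eventuallyEq heq)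
    norm_num at this
    linarith

/-- A smooth cutoff function with support in `(-d, d)` that is constant `1` near a given compact
subset. -/
lemma exists_smooth_cutoff_Ioo {d : ℝ} (hd : 0 < d) {K : Set ℝ} (hK : IsCompact K)
    (hKd : K ⊆ Ioo (-d) d) :
    ∃ g : ℝ → ℝ, ContDiff ℝ (⊤ : ℕ∞) g ∧ HasCompactSupport g ∧ tsupport g ⊆ Ioo (-d) d ∧
      ∀ r ∈ K, g =ᶠ[nhds r] 1 := by
  have hball : Metric.ball (0 : ℝ) d = Ioo (-d) d := by simp [Real.ball_eq_Ioo]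
  obtain ⟨ρ, hρ, hKρ⟩ := exists_pos_lt_subset_ball hd hK.isClosed (hball ▸ hKd)
  let g : ContDiffBump (0 : ℝ) := ⟨ρ, (ρ + d) / 2, hρ.1, by linarith [hρ.2]⟩
  refine ⟨g, g.contDiff, g.hasCompactSupport, ?_, fun r hr => g.eventuallyEq_one_of_mem_ball (hKρ hr)⟩
  rw [g.tsupport_eq, ← hball]
  exact Metric.closedBall_subset_ball (show (ρ + d) / 2 < d by linarith [hρ.2])

lemma integral_neg_sq_sin_add_mul_sq_cos (A B : ℝ) :
    ∫ θ in (-π)..π, A * (-(sin θ) ^ 2 + B * (cos θ) ^ 2) = π * A * (B - 1) := by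
  have h : IntervalIntegrable (fun θ => -(sin θ) ^ 2) MeasureTheory.volume (-π) π :=
    Continuous.intervalIntegrable (by fun_prop) _ _
  have h' : IntervalIntegrable (fun θ => B * (cos θ) ^ 2) MeasureTheory.volume (-π) π :=
    Continuous.intervalIntegrable (by fun_prop) _ _
  rw [intervalIntegral.integral_const_mul, intervalIntegral.integral_add h h',
    intervalIntegral.integral_neg, intervalIntegral.integral_const_mul, integral_sin_sq,
    integral_cos_sq]
  simp
  ring

/-- On the ellipsoid of revolution `x² + y² = a²(1 - z²)` with `a > 1`
(with profile curve `(c₁, c₂)` parametrized by arc length and induced metric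
`dr² + c₁(r)²·dθ²`), every zonal flow `V = F(r)∂_θ` supported away from the poles
admits a divergence-free field `W = W₁∂_r + W₂∂_θ` with positive Misiołek curvature
`MC_{V,W} = ∫∫ F²·c₁·(-(∂_θW₁)² - c₁²(∂_rW₁)² + ((c₁′)² - c₁c₁″)·W₁²) dθ dr > 0`. -/
theorem ellipsoid_exists_positive_misiolek_curvature
    (a d : ℝ) (ha : 1 < a) (hd : 0 < d) (c₁ c₂ : ℝ → ℝ)
    (hc₁ : ContDiffOn ℝ (⊤ : ℕ∞) c₁ (Ioo (-d) d))
    (hc₂ : ContDiffOn ℝ (⊤ : ℕ∞) c₂ (Ioo (-d) d))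
    (hpos : ∀ r ∈ Ioo (-d) d, 0 < c₁ r)
    (hell : ∀ r ∈ Ioo (-d) d, (c₁ r) ^ 2 = a ^ 2 * (1 - (c₂ r) ^ 2))
    (harc : ∀ r ∈ Ioo (-d) d, (deriv c₁ r) ^ 2 + (deriv c₂ r) ^ 2 = 1)
    (hmono : ∀ r ∈ Ioo (-d) d, 0 < deriv c₂ r)
    (F : ℝ → ℝ)
    (hF : ContDiff ℝ (⊤ : ℕ∞) F) (hFsupp : HasCompactSupport F)
    (hFsub : tsupport F ⊆ Ioo (-d) d)
    (hFne : ∃ r, F r ≠ 0) :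
    ∃ W₁ W₂ : ℝ → ℝ → ℝ,
      ContDiffOn ℝ (⊤ : ℕ∞) (fun p : ℝ × ℝ => W₁ p.1 p.2) ((Ioo (-d) d) ×ˢ (univ : Set ℝ)) ∧
      ContDiffOn ℝ (⊤ : ℕ∞) (fun p : ℝ × ℝ => W₂ p.1 p.2) ((Ioo (-d) d) ×ˢ (univ : Set ℝ)) ∧
      (∀ r θ : ℝ, W₁ r (θ + 2 * π) = W₁ r θ) ∧
      (∀ r θ : ℝ, W₂ r (θ + 2 * π) = W₂ r θ) ∧
      (∃ K : Set ℝ, IsCompact K ∧ K ⊆ Ioo (-d) d ∧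
        ∀ r ∉ K, ∀ θ : ℝ, W₁ r θ = 0 ∧ W₂ r θ = 0) ∧
      (∀ r ∈ Ioo (-d) d, ∀ θ : ℝ,
        deriv (fun s => W₁ s θ) r + (deriv c₁ r / c₁ r) * W₁ r θ + deriv (W₂ r) θ = 0) ∧
      0 < ∫ r in (-d)..d, ∫ θ in (-π)..π,
            F r ^ 2 * c₁ r *
              (-(deriv (W₁ r) θ) ^ 2 - (c₁ r) ^ 2 * (deriv (fun s => W₁ s θ) r) ^ 2
                + ((deriv c₁ r) ^ 2 - c₁ r * deriv (deriv c₁) r) * (W₁ r θ) ^ 2) := by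
  have hI : IsOpen (Ioo (-d) d) := isOpen_Ioo
  have hgt : ∀ r ∈ Ioo (-d) d, 1 < (deriv c₁ r) ^ 2 - c₁ r * deriv (deriv c₁) r := fun r hr =>
    one_lt_deriv_sq_sub_mul_deriv_deriv ha hI hc₁ hc₂ hpos hell harc hmono hr
  have hc₁' : ContDiffOn ℝ (⊤ : ℕ∞) (deriv c₁) (Ioo (-d) d) := hc₁.deriv_of_isOpen hI (by simp)
  have hc₁'' : ContDiffOn ℝ (⊤ : ℕ∞) (deriv (deriv c₁)) (Ioo (-d) d) :=
    hc₁'.deriv_of_isOpen hI (by simp)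
  obtain ⟨g, hg, hgc, hgd, hg1⟩ := exists_smooth_cutoff_Ioo hd hFsupp hFsub
  have hg' : ContDiff ℝ (⊤ : ℕ∞) (deriv g) := hg.deriv'
  have hdg : ∀ r θ, deriv (fun s => g s * cos θ) r = deriv g r * cos θ := fun r θ =>
    deriv_mul_const (hg.differentiable (by simp) r) _
  have hfst : MapsTo Prod.fst (Ioo (-d) d ×ˢ (univ : Set ℝ)) (Ioo (-d) d) := fun p hp => hp.1
  refine ⟨fun r θ => g r * cos θ, fun r θ => -(deriv g r + deriv c₁ r / c₁ r * g r) * sin θ,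
    ?_, ?_, ?_, ?_, ⟨tsupport g, hgc, hgd, ?_⟩, ?_, ?_⟩
  · exact ((hg.comp contDiff_fst).mul (Real.contDiff_cos.comp contDiff_snd)).contDiffOn
  · have hcoef : ContDiffOn ℝ (⊤ : ℕ∞) (fun r => -(deriv g r + deriv c₁ r / c₁ r * g r))
        (Ioo (-d) d) :=
      (hg'.contDiffOn.add
        ((hc₁'.div hc₁ fun r hr => (hpos r hr).ne').mul hg.contDiffOn)).neg
    exact (hcoef.comp contDiff_fst.contDiffOn hfst).mul
      (Real.contDiff_sin.comp contDiff_snd).contDiffOn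
  · simp
  · simp
  · intro r hr θ
    have h0 : g r = 0 := image_eq_zero_of_notMem_tsupport hr
    have h1 : deriv g r = 0 :=
      image_eq_zero_of_notMem_tsupport fun h => hr (tsupport_deriv_subset h)
    simp [h0, h1]
  · intro r _ θ
    rw [hdg, deriv_const_mul _ Real.differentiableAt_sin, Real.deriv_sin]
    ring
  · set B : ℝ → ℝ := fun r => (deriv c₁ r) ^ 2 - c₁ r * deriv (deriv c₁) r
    have hinner : ∀ r, (∫ θ in (-π)..π, F r ^ 2 * c₁ r *
        (-(deriv (fun t => g r * cos t) θ) ^ 2 - (c₁ r) ^ 2 * (deriv (fun s => g s * cos θ) r) ^ 2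
          + ((deriv c₁ r) ^ 2 - c₁ r * deriv (deriv c₁) r) * (g r * cos θ) ^ 2))
        = F r ^ 2 * (π * c₁ r * (B r - 1)) := by
      intro r
      by_cases hr : r ∈ tsupport F
      · have h0 : g r = 1 := (hg1 r hr).eq_of_nhds
        have h1 : deriv g r = 0 := by simp [(hg1 r hr).deriv_eq]
        calc _ = ∫ θ in (-π)..π, F r ^ 2 * c₁ r * (-(sin θ) ^ 2 + B r * (cos θ) ^ 2) := by
              congr 1
              ext θ
              rw [hdg, h1, h0]
              simp [B]
          _ = _ := by rw [integral_neg_sq_sin_add_mul_sq_cos]; ring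
      · simp [image_eq_zero_of_notMem_tsupport hr]
    simp only [hinner]
    have hcont : Continuous fun r => F r ^ 2 * (π * c₁ r * (B r - 1)) := by
      rw [continuous_iff_continuousAt]
      intro r
      by_cases hr : r ∈ tsupport F
      · have hn := hI.mem_nhds (hFsub hr)
        have k₀ := hc₁.continuousOn.continuousAt hn
        have k₁ := hc₁'.continuousOn.continuousAt hn
        have k₂ := hc₁''.continuousOn.continuousAt hn
        have k₃ := hF.continuous.continuousAt (x := r)
        fun_prop
      · have h0 := notMem_tsupport_iff_eventuallyEq.mp hr
        refine (continuousAt_const (y := (0 : ℝ))).congr ?_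
        filter_upwards [h0] with x hx
        simp [hx]
    have hposF : ∀ r, F r ≠ 0 → 0 < F r ^ 2 * (π * c₁ r * (B r - 1)) := by
      intro r hr
      have hrI := hFsub (subset_tsupport F hr)
      have h1 := hpos r hrI
      have h2 : 0 < B r - 1 := sub_pos.mpr (hgt r hrI)
      positivity
    obtain ⟨r₀, hr₀⟩ := hFne
    refine intervalIntegral.integral_pos (by linarith) hcont.continuousOn (fun r _ => ?_)
      ⟨r₀, Ioo_subset_Icc_self (hFsub (subset_tsupport F hr₀)), hposF r₀ hr₀⟩
    by_cases hr : F r = 0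
    · simp [hr]
    · exact (hposF r hr).le
end

section
/- Let δ > 0 and let φ : (−δ, δ) → ℝ be a smooth function with φ(0) = 0, φ′(0) = 1, and φ^{(2n)}(0) = 0 for every integer n ≥ 1. Then there exists a smooth function G on the open disk {(a, b) ∈ ℝ² : a² + b² < δ²} such that G(a, b) = ( φ(√(a² + b²))² − (a² + b²) ) / (a² + b²)² for all (a, b) ≠ (0, 0). Consequently the surface-of-revolution metric components 1 + G·b², G·a·b, 1 + G·a² are smooth across the origin. -/
open Real Set

open scoped ContDiff Topology

/-- Differentiation under the integral sign for the weighted means of the dilates of a function. -/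
theorem hasDerivAt_integral_pow_mul_comp_mul {δ : ℝ} {k : ℝ → ℝ}
    (hk : ContDiffOn ℝ ∞ k (Ioo (-δ) δ)) (m : ℕ) {t : ℝ} (ht : t ∈ Ioo (-δ) δ) :
    HasDerivAt (fun t => ∫ s in (0 : ℝ)..1, s ^ m * k (t * s))
      (∫ s in (0 : ℝ)..1, s ^ (m + 1) * deriv k (t * s)) t := by
  obtain ⟨r, htr, hrδ⟩ := exists_between (abs_lt.2 ht)
  have hk' : ContDiffOn ℝ ∞ (deriv k) (Ioo (-δ) δ) :=
    ((contDiffOn_infty_iff_deriv_of_isOpen isOpen_Ioo).1 hk).2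
  have hmem : ∀ x ∈ Ioo (-r) r, ∀ s ∈ Icc (0 : ℝ) 1, x * s ∈ Icc (-r) r := by
    intro x hx s hs
    rw [mem_Icc, ← abs_le, abs_mul, abs_of_nonneg hs.1]
    nlinarith [abs_lt.2 hx, abs_nonneg x, hs.1, hs.2]
  have hsub : Icc (-r) r ⊆ Ioo (-δ) δ := Icc_subset_Ioo (by linarith) hrδ
  have hcont : ∀ (j : ℕ) (f : ℝ → ℝ), ContinuousOn f (Ioo (-δ) δ) → ∀ x ∈ Ioo (-r) r,
      ContinuousOn (fun s => s ^ j * f (x * s)) (uIcc (0 : ℝ) 1) := by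
    intro j f hf x hx
    rw [uIcc_of_le zero_le_one]
    exact (by fun_prop : ContinuousOn (fun s : ℝ => s ^ j) _).mul
      (hf.comp (by fun_prop) fun s hs => hsub (hmem x hx s hs))
  obtain ⟨C, hC⟩ := isCompact_Icc.exists_bound_of_continuousOn (hk'.continuousOn.mono hsub)
  have hr : Ioo (-r) r ∈ 𝓝 t := Ioo_mem_nhds (abs_lt.1 htr).1 (abs_lt.1 htr).2
  have htr' : t ∈ Ioo (-r) r := abs_lt.1 htr
  refine (intervalIntegral.hasDerivAt_integral_of_dominated_loc_of_deriv_le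
    (F := fun t s => s ^ m * k (t * s)) (F' := fun t s => s ^ (m + 1) * deriv k (t * s))
    (bound := fun _ => C) hr ?_ (hcont m k hk.continuousOn t htr').intervalIntegrable
    (hcont (m + 1) _ hk'.continuousOn t htr').intervalIntegrable.aestronglyMeasurable_restrict_uIoc
    ?_ intervalIntegrable_const ?_).2
  · filter_upwards [hr] with x hx
    exact (hcont m k hk.continuousOn x hx).intervalIntegrable.aestronglyMeasurable_restrict_uIoc
  · refine .of_forall fun s hs x hx => ?_
    rw [uIoc_of_le zero_le_one] at hs
    have hs' : s ∈ Icc (0 : ℝ) 1 := ⟨hs.1.le, hs.2⟩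
    rw [norm_mul, norm_pow, Real.norm_of_nonneg hs.1.le]
    calc s ^ (m + 1) * ‖deriv k (x * s)‖ ≤ 1 * ‖deriv k (x * s)‖ := by
          gcongr
          exact pow_le_one₀ hs'.1 hs'.2
      _ ≤ C := by
          rw [one_mul]
          exact hC _ (hmem x hx s hs')
  · refine .of_forall fun s hs x hx => ?_
    rw [uIoc_of_le zero_le_one] at hs
    have hxs := hsub (hmem x hx s ⟨hs.1.le, hs.2⟩)
    have hd : HasDerivAt k (deriv k (x * s)) (x * s) :=
      ((hk.differentiableOn (by simp)).differentiableAt (isOpen_Ioo.mem_nhds hxs)).hasDerivAt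
    convert! (hd.comp x (hasDerivAt_mul_const s)).const_mul (s ^ m) using 1
    ring

theorem contDiffOn_integral_pow_mul_comp_mul {δ : ℝ} {k : ℝ → ℝ}
    (hk : ContDiffOn ℝ ∞ k (Ioo (-δ) δ)) (m : ℕ) :
    ContDiffOn ℝ ∞ (fun t => ∫ s in (0 : ℝ)..1, s ^ m * k (t * s)) (Ioo (-δ) δ) := by
  refine contDiffOn_infty.2 fun n => ?_
  induction n generalizing m k with
  | zero =>
    exact contDiffOn_zero.2 fun t ht =>
      (hasDerivAt_integral_pow_mul_comp_mul hk m ht).continuousAt.continuousWithinAt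
  | succ n ih =>
    have hd := fun t ht => hasDerivAt_integral_pow_mul_comp_mul hk m (t := t) ht
    push_cast
    refine (contDiffOn_succ_iff_deriv_of_isOpen isOpen_Ioo).2
      ⟨fun t ht => (hd t ht).differentiableAt.differentiableWithinAt, by simp, ?_⟩
    exact (ih ((contDiffOn_infty_iff_deriv_of_isOpen isOpen_Ioo).1 hk).2 (m + 1)).congr
      fun t ht => (hd t ht).deriv

theorem iteratedDeriv_integral_pow_mul_comp_mul_zero {δ : ℝ} (hδ : 0 < δ) {k : ℝ → ℝ}
    (hk : ContDiffOn ℝ ∞ k (Ioo (-δ) δ)) (m n : ℕ) :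
    iteratedDeriv n (fun t => ∫ s in (0 : ℝ)..1, s ^ m * k (t * s)) 0 =
      iteratedDeriv n k 0 / (m + n + 1) := by
  induction n generalizing m k with
  | zero =>
    simp [integral_pow]
    ring
  | succ n ih =>
    have hev : deriv (fun t => ∫ s in (0 : ℝ)..1, s ^ m * k (t * s)) =ᶠ[𝓝 0]
        fun t => ∫ s in (0 : ℝ)..1, s ^ (m + 1) * deriv k (t * s) := by
      filter_upwards [Ioo_mem_nhds (neg_lt_zero.2 hδ) hδ] with t ht
      exact (hasDerivAt_integral_pow_mul_comp_mul hk m ht).deriv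
    rw [iteratedDeriv_succ', hev.iteratedDeriv_eq, iteratedDeriv_succ',
      ih ((contDiffOn_infty_iff_deriv_of_isOpen isOpen_Ioo).1 hk).2]
    push_cast
    ring

/-- Hadamard's formula for the difference quotient at the origin. -/
theorem dslope_zero_eqOn_integral {δ : ℝ} {k : ℝ → ℝ}
    (hk : ContDiffOn ℝ ∞ k (Ioo (-δ) δ)) :
    EqOn (dslope k 0) (fun t => ∫ s in (0 : ℝ)..1, s ^ 0 * deriv k (t * s)) (Ioo (-δ) δ) := by
  intro t ht
  rcases eq_or_ne t 0 with rfl | h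
  · simp
  have hsub : uIcc 0 t ⊆ Ioo (-δ) δ := by
    refine ordConnected_Ioo.uIcc_subset ⟨?_, ?_⟩ ht <;> linarith [ht.1, ht.2]
  have hint : ∫ y in (0 : ℝ)..t, deriv k y = k t - k 0 :=
    intervalIntegral.integral_deriv_eq_sub
      (fun x hx => (hk.differentiableOn (by simp)).differentiableAt
        (isOpen_Ioo.mem_nhds (hsub hx)))
      ((((contDiffOn_infty_iff_deriv_of_isOpen isOpen_Ioo).1 hk).2.continuousOn.mono
        hsub).intervalIntegrable)
  have hscale := intervalIntegral.mul_integral_comp_mul_left (a := 0) (b := 1)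
    (f := deriv k) (c := t)
  simp only [mul_zero, mul_one, hint] at hscale
  simp only [pow_zero, one_mul]
  rw [dslope_of_ne _ h, slope_def_field, ← hscale]
  field_simp
  ring

theorem contDiffOn_dslope_zero {δ : ℝ} {k : ℝ → ℝ} (hk : ContDiffOn ℝ ∞ k (Ioo (-δ) δ)) :
    ContDiffOn ℝ ∞ (dslope k 0) (Ioo (-δ) δ) :=
  (contDiffOn_integral_pow_mul_comp_mul
    ((contDiffOn_infty_iff_deriv_of_isOpen isOpen_Ioo).1 hk).2 0).congr
    (dslope_zero_eqOn_integral hk)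

theorem iteratedDeriv_dslope_zero {δ : ℝ} (hδ : 0 < δ) {k : ℝ → ℝ}
    (hk : ContDiffOn ℝ ∞ k (Ioo (-δ) δ)) (n : ℕ) :
    iteratedDeriv n (dslope k 0) 0 = iteratedDeriv (n + 1) k 0 / (n + 1) := by
  have h0 : (0 : ℝ) ∈ Ioo (-δ) δ := ⟨neg_lt_zero.2 hδ, hδ⟩
  rw [(dslope_zero_eqOn_integral hk).iteratedDeriv_of_isOpen isOpen_Ioo n h0,
    iteratedDeriv_integral_pow_mul_comp_mul_zero hδ
      ((contDiffOn_infty_iff_deriv_of_isOpen isOpen_Ioo).1 hk).2, iteratedDeriv_succ']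
  simp

theorem hasFDerivAt_comp_norm {E : Type*} [NormedAddCommGroup E] [InnerProductSpace ℝ E]
    {k : ℝ → ℝ} {x : E} (hk : DifferentiableAt ℝ k ‖x‖) (h0 : deriv k 0 = 0) :
    HasFDerivAt (fun y : E => k ‖y‖) (dslope (deriv k) 0 ‖x‖ • innerSL ℝ x) x := by
  rcases eq_or_ne x 0 with rfl | hx
  · rw [norm_zero] at hk
    have hd := hk.hasDerivAt
    rw [h0, hasDerivAt_iff_isLittleO] at hd
    rw [hasFDerivAt_iff_isLittleO]
    have htend : Filter.Tendsto (fun y : E => ‖y‖) (𝓝 0) (𝓝 0) := tendsto_norm_zero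
    refine Asymptotics.IsLittleO.of_norm_right ?_
    simpa [Function.comp_def] using hd.comp_tendsto htend
  · have hx' : ‖x‖ ≠ 0 := norm_ne_zero_iff.2 hx
    have hn := (hasStrictFDerivAt_norm_sq x).hasFDerivAt.sqrt (by positivity)
    simp only [Real.sqrt_sq (norm_nonneg _)] at hn
    convert! hk.hasDerivAt.comp_hasFDerivAt x hn using 1
    ext y
    simp [dslope_of_ne _ hx', slope_def_field, h0]
    field_simp

/-- A smooth function of one variable whose odd derivatives vanish at the origin becomes a smooth
function when composed with the norm of an inner product space. -/
theorem contDiffOn_comp_norm {E : Type*} [NormedAddCommGroup E] [InnerProductSpace ℝ E]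
    {δ : ℝ} {k : ℝ → ℝ} (hk : ContDiffOn ℝ ∞ k (Ioo (-δ) δ))
    (hodd : ∀ n : ℕ, iteratedDeriv (2 * n + 1) k 0 = 0) :
    ContDiffOn ℝ ∞ (fun x : E => k ‖x‖) (Metric.ball 0 δ) := by
  have hmaps : ∀ x ∈ Metric.ball (0 : E) δ, ‖x‖ ∈ Ioo (-δ) δ := by
    intro x hx
    rw [mem_ball_zero_iff] at hx
    exact ⟨by linarith [norm_nonneg x], hx⟩
  refine contDiffOn_infty.2 fun n => ?_
  induction n generalizing k with
  | zero =>
    exact contDiffOn_zero.2 (hk.continuousOn.comp continuous_norm.continuousOn hmaps)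
  | succ n ih =>
    rcases le_or_gt δ 0 with hδ | hδ
    · simp [Metric.ball_eq_empty.2 hδ]
    have hk' := ((contDiffOn_infty_iff_deriv_of_isOpen isOpen_Ioo).1 hk).2
    have hd : ∀ x ∈ Metric.ball (0 : E) δ, HasFDerivAt (fun y : E => k ‖y‖)
        (dslope (deriv k) 0 ‖x‖ • innerSL ℝ x) x := fun x hx =>
      hasFDerivAt_comp_norm ((hk.differentiableOn (by simp)).differentiableAt
        (isOpen_Ioo.mem_nhds (hmaps x hx))) (by simpa using hodd 0)
    push_cast
    refine (contDiffOn_succ_iff_fderiv_of_isOpen Metric.isOpen_ball).2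
      ⟨fun x hx => (hd x hx).differentiableAt.differentiableWithinAt, by simp, ?_⟩
    refine ContDiffOn.congr ?_ fun x hx => (hd x hx).fderiv
    refine (ih (contDiffOn_dslope_zero hk') fun j => ?_).smul (innerSL ℝ).contDiff.contDiffOn
    rw [iteratedDeriv_dslope_zero hδ hk', ← iteratedDeriv_succ',
      show 2 * j + 1 + 1 + 1 = 2 * (j + 1) + 1 by ring, hodd, zero_div]

/-- If `φ` is smooth on `(-δ, δ)` with `φ(0) = 0`, `φ′(0) = 1` and all
even-order derivatives of order `≥ 2` vanishing at `0`, then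
`(a, b) ↦ (φ(√(a² + b²))² - (a² + b²)) / (a² + b²)²` extends to a smooth function `G`
on the disk `a² + b² < δ²`; consequently the surface-of-revolution metric components
`1 + G·b²`, `G·a·b`, `1 + G·a²` are smooth across the origin. -/
theorem pole_metric_smooth_extension
    (δ : ℝ) (hδ : 0 < δ) (φ : ℝ → ℝ)
    (hφ : ContDiffOn ℝ (⊤ : ℕ∞) φ (Ioo (-δ) δ))
    (h0 : φ 0 = 0) (h1 : deriv φ 0 = 1)
    (heven : ∀ n : ℕ, 1 ≤ n → iteratedDeriv (2 * n) φ 0 = 0) :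
    ∃ G : ℝ × ℝ → ℝ,
      ContDiffOn ℝ (⊤ : ℕ∞) G {p : ℝ × ℝ | p.1 ^ 2 + p.2 ^ 2 < δ ^ 2} ∧
      (∀ p : ℝ × ℝ, p.1 ^ 2 + p.2 ^ 2 < δ ^ 2 → p ≠ (0, 0) →
        G p = ((φ (Real.sqrt (p.1 ^ 2 + p.2 ^ 2))) ^ 2 - (p.1 ^ 2 + p.2 ^ 2))
                / (p.1 ^ 2 + p.2 ^ 2) ^ 2) ∧
      ContDiffOn ℝ (⊤ : ℕ∞) (fun p : ℝ × ℝ => 1 + G p * p.2 ^ 2)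
        {p : ℝ × ℝ | p.1 ^ 2 + p.2 ^ 2 < δ ^ 2} ∧
      ContDiffOn ℝ (⊤ : ℕ∞) (fun p : ℝ × ℝ => G p * p.1 * p.2)
        {p : ℝ × ℝ | p.1 ^ 2 + p.2 ^ 2 < δ ^ 2} ∧
      ContDiffOn ℝ (⊤ : ℕ∞) (fun p : ℝ × ℝ => 1 + G p * p.1 ^ 2)
        {p : ℝ × ℝ | p.1 ^ 2 + p.2 ^ 2 < δ ^ 2} := by
  set ψ := dslope φ 0
  have hψ : ContDiffOn ℝ ∞ ψ (Ioo (-δ) δ) := contDiffOn_dslope_zero hφ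
  have hψ_odd : ∀ n : ℕ, iteratedDeriv (2 * n + 1) ψ 0 = 0 := fun n => by
    rw [iteratedDeriv_dslope_zero hδ hφ, show 2 * n + 1 + 1 = 2 * (n + 1) by ring,
      heven (n + 1) (by omega), zero_div]
  set χ := dslope (dslope ψ 0) 0
  have hχ : ContDiffOn ℝ ∞ χ (Ioo (-δ) δ) := contDiffOn_dslope_zero (contDiffOn_dslope_zero hψ)
  have hχ_odd : ∀ n : ℕ, iteratedDeriv (2 * n + 1) χ 0 = 0 := fun n => by
    rw [iteratedDeriv_dslope_zero hδ (contDiffOn_dslope_zero hψ), iteratedDeriv_dslope_zero hδ hψ,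
      show 2 * n + 1 + 1 + 1 = 2 * (n + 1) + 1 by ring, hψ_odd, zero_div, zero_div]
  have hψ0 : ψ 0 = 1 := (dslope_same φ 0).trans h1
  have hdψ0 : dslope ψ 0 0 = 0 := by simpa using hψ_odd 0
  have hφψ : ∀ t, φ t = t * ψ t := fun t => by
    simpa [h0] using (sub_smul_dslope φ 0 t).symm
  have hψχ : ∀ t, ψ t = 1 + t ^ 2 * χ t := fun t => by
    have e1 := sub_smul_dslope ψ 0 t
    have e2 := sub_smul_dslope (dslope ψ 0) 0 t
    simp only [hdψ0, hψ0, sub_zero, smul_eq_mul] at e1 e2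
    linear_combination -e1 - t * e2
  let z : ℝ × ℝ → ℂ := Complex.equivRealProdCLM.symm
  have hz_norm : ∀ p, ‖z p‖ = √(p.1 ^ 2 + p.2 ^ 2) := fun p => by
    simp [z, Complex.norm_eq_sqrt_sq_add_sq]
  have hz_maps : MapsTo z {p : ℝ × ℝ | p.1 ^ 2 + p.2 ^ 2 < δ ^ 2} (Metric.ball 0 δ) := by
    intro p hp
    rw [mem_ball_zero_iff, hz_norm]
    exact (Real.sqrt_lt' hδ).2 hp
  have hz : ContDiff ℝ ∞ z := Complex.equivRealProdCLM.symm.contDiff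
  have hG : ContDiffOn ℝ ∞ (fun p => χ ‖z p‖ * (ψ ‖z p‖ + 1))
      {p : ℝ × ℝ | p.1 ^ 2 + p.2 ^ 2 < δ ^ 2} :=
    ((contDiffOn_comp_norm hχ hχ_odd).comp hz.contDiffOn hz_maps).mul
      (((contDiffOn_comp_norm hψ hψ_odd).comp hz.contDiffOn hz_maps).add contDiffOn_const)
  refine ⟨fun p => χ ‖z p‖ * (ψ ‖z p‖ + 1), hG, ?_, ?_, ?_, ?_⟩
  · intro p _ hp
    have hpos : 0 < p.1 ^ 2 + p.2 ^ 2 := by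
      by_contra! h
      exact hp (Prod.ext (by nlinarith [sq_nonneg p.1, sq_nonneg p.2])
        (by nlinarith [sq_nonneg p.1, sq_nonneg p.2]))
    simp only [hz_norm]
    rw [eq_div_iff (by positivity), hφψ]
    set t := √(p.1 ^ 2 + p.2 ^ 2)
    have ht : p.1 ^ 2 + p.2 ^ 2 = t ^ 2 := (Real.sq_sqrt hpos.le).symm
    rw [ht]
    linear_combination (-(t ^ 2) * (ψ t + 1)) * hψχ t
  · exact contDiffOn_const.add (hG.mul (by fun_prop))
  · exact (hG.mul (by fun_prop)).mul (by fun_prop)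
  · exact contDiffOn_const.add (hG.mul (by fun_prop))
end

section
/- Let m > 0, w > 0, p ≥ 0 and 1 < k < l be real numbers. Set t_k := π·w·√(k/m), f_k(t) := sin( (t/w)·√(m/k) ) and f_l(t) := sin( (t/w)·√(m/l) ). Then ∫_0^{t_k} ( w²·f_k′(t)·f_l′(t) + p·f_k(t)·f_l(t) ) dt > 0. -/
open Real Set

theorem hasDerivAt_sin_const_mul (a t : ℝ) :
    HasDerivAt (fun s => Real.sin (a * s)) (a * Real.cos (a * t)) t := by
  simpa [mul_comm] using ((hasDerivAt_id t).const_mul a).sin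

theorem hasDerivAt_cos_const_mul (a t : ℝ) :
    HasDerivAt (fun s => Real.cos (a * s)) (-(a * Real.sin (a * t))) t := by
  simpa [mul_comm] using ((hasDerivAt_id t).const_mul a).cos

/-- The combined energy and mass pairing of two sine waves of frequencies `a ≠ b` over a half
period of the first one. -/
theorem integral_cos_mul_cos_add_sin_mul_sin {a b : ℝ} (c p : ℝ) (ha : a ≠ 0)
    (hab : a ^ 2 - b ^ 2 ≠ 0) :
    ∫ t in (0:ℝ)..(π / a), (c * (a * Real.cos (a * t)) * (b * Real.cos (b * t))
        + p * Real.sin (a * t) * Real.sin (b * t))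
      = (c * a * b ^ 2 + p * a) * Real.sin (b * (π / a)) / (a ^ 2 - b ^ 2) := by
  have hF (t : ℝ) : HasDerivAt (fun t =>
      (c * a * b * (a * (Real.sin (a * t) * Real.cos (b * t))
          - b * (Real.cos (a * t) * Real.sin (b * t)))
        + p * (b * (Real.sin (a * t) * Real.cos (b * t))
          - a * (Real.cos (a * t) * Real.sin (b * t)))) / (a ^ 2 - b ^ 2))
      (c * (a * Real.cos (a * t)) * (b * Real.cos (b * t))
        + p * Real.sin (a * t) * Real.sin (b * t)) t := by
    have hsc := (hasDerivAt_sin_const_mul a t).mul (hasDerivAt_cos_const_mul b t)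
    have hcs := (hasDerivAt_cos_const_mul a t).mul (hasDerivAt_sin_const_mul b t)
    refine ((((hsc.const_mul a).sub (hcs.const_mul b)).const_mul (c * a * b)).add
      (((hsc.const_mul b).sub (hcs.const_mul a)).const_mul p)).div_const (a ^ 2 - b ^ 2)
      |>.congr_deriv ?_
    field_simp
    ring
  rw [intervalIntegral.integral_eq_sub_of_hasDerivAt (fun t _ => hF t)
    (Continuous.intervalIntegrable (by fun_prop) _ _), mul_div_cancel₀ π ha]
  simp only [Real.sin_pi, Real.cos_pi, mul_zero, Real.sin_zero]
  ring

/-- With `t_k = π·w·√(k/m)`, `f_k(t) = sin((t/w)·√(m/k))` and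
`f_l(t) = sin((t/w)·√(m/l))` for `1 < k < l`, and any `p ≥ 0`,
`∫₀^{t_k} (w²·f_k′·f_l′ + p·f_k·f_l) dt > 0`; i.e. the variation fields `W̃ᵏ`, `W̃ˡ`
are not orthogonal. -/
theorem variation_fields_not_orthogonal
    (m w p k l : ℝ) (hm : 0 < m) (hw : 0 < w) (hp : 0 ≤ p) (hk : 1 < k) (hkl : k < l) :
    0 < ∫ t in (0:ℝ)..(π * w * Real.sqrt (k / m)),
        (w ^ 2 * deriv (fun s => Real.sin (s / w * Real.sqrt (m / k))) t
            * deriv (fun s => Real.sin (s / w * Real.sqrt (m / l))) t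
          + p * Real.sin (t / w * Real.sqrt (m / k))
            * Real.sin (t / w * Real.sqrt (m / l))) := by
  have hl : 0 < l := by linarith
  have hk0 : 0 < k := by linarith
  set a := √(m / k) / w with ha_def
  set b := √(m / l) / w with hb_def
  have hb : 0 < b := by positivity
  have hba : b < a := by
    rw [ha_def, hb_def]
    gcongr
  have ha : 0 < a := hb.trans hba
  have hT : π * w * √(k / m) = π / a := by
    rw [ha_def, ← inv_div m k, Real.sqrt_inv]
    field_simp
  have hfa (s : ℝ) : s / w * √(m / k) = a * s := by rw [ha_def]; ring
  have hfb (s : ℝ) : s / w * √(m / l) = b * s := by rw [hb_def]; ring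
  have hsq : 0 < a ^ 2 - b ^ 2 := by nlinarith
  simp only [hT, hfa, hfb, (hasDerivAt_sin_const_mul _ _).deriv]
  rw [integral_cos_mul_cos_add_sin_mul_sin _ _ ha.ne' hsq.ne']
  have hsin : 0 < Real.sin (b * (π / a)) := by
    refine Real.sin_pos_of_pos_of_lt_pi (by positivity) ?_
    rw [← mul_div_assoc, div_lt_iff₀ ha, mul_comm]
    gcongr
  positivity
end
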